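/- Let X be a weakly Cohen–Macaulay simplicial complex of level n, Y a finite simplicial complex of dimension at most n, Z a subcomplex of Y, and f₀: Y → X a simplicial map. Then f₀ is homotopic, relative to Z, to a map f₁ which is simplicial with respect to a triangulation of Y subdividing the original one (unchanged on Z), and which is simplexwise injective relative to Z: whenever an edge [v,w] of the new triangulation satisfies f₁(v) = f₁(w), that edge lies in Z. -/

import Mathlib

open scoped BigOperators

structure ASC (V : Type) where
  faces : Set (Finset V)
  nonempty_of_mem : ∀ ⦃s⦄, s ∈ faces → s.Nonempty
  down_closed : ∀ ⦃s t : Finset V⦄, s ∈ faces → t ⊆ s → t.Nonempty → t ∈ faces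

namespace ASC

variable {V W : Type} [DecidableEq V] [DecidableEq W]

/-- The geometric realization of an abstract simplicial complex, as a subset of `V → ℝ`
(barycentric coordinates, with the product topology on the subtype). -/
def space (K : ASC V) : Set (V → ℝ) :=
  {x | (∀ v, 0 ≤ x v) ∧ ∃ s ∈ K.faces, (∀ v, v ∉ s → x v = 0) ∧ ∑ v ∈ s, x v = 1}

/-- A vertex map is simplicial if it sends faces to faces. -/
def IsSimplicial (K : ASC V) (L : ASC W) (φ : V → W) : Prop :=
  ∀ s ∈ K.faces, s.image φ ∈ L.faces

/-- The map induced on geometric realizations by a vertex map. -/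
noncomputable def push (φ : V → W) (x : V → ℝ) : W → ℝ :=
  fun w => ∑ᶠ v ∈ φ ⁻¹' {w}, x v

/-- The link of a simplex. -/
def link (K : ASC V) (σ : Finset V) : ASC V where
  faces := {t | t ∈ K.faces ∧ Disjoint σ t ∧ σ ∪ t ∈ K.faces}
  nonempty_of_mem := fun _ ht => K.nonempty_of_mem ht.1
  down_closed := by
    rintro t u ⟨h1, h2, h3⟩ hsub hne
    exact ⟨K.down_closed h1 hsub hne, h2.mono_right hsub,
      K.down_closed h3 (Finset.union_subset_union_right hsub)
        ⟨hne.choose, Finset.mem_union_right _ hne.choose_spec⟩⟩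

end ASC

/-- `n`-connectedness of a space (`n` an integer): nonempty when `n ≥ -1`, and all homotopy
groups in dimensions `≤ n` vanish, at every basepoint. -/
def IsConn (X : Type) [TopologicalSpace X] (n : ℤ) : Prop :=
  (-1 ≤ n → Nonempty X) ∧
    ∀ i : ℕ, (i : ℤ) ≤ n → ∀ x : X, Subsingleton (HomotopyGroup (Fin i) X x)


/-- `K` is weakly Cohen–Macaulay of level `n`: it is `(n−1)`-connected and the link of each
`k`-simplex is `(n−k−2)`-connected. -/
def WCM {V : Type} [DecidableEq V] (K : ASC V) (n : ℤ) : Prop :=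
  IsConn (↥K.space) (n - 1) ∧ ∀ s ∈ K.faces, IsConn (↥(K.link s).space) (n - s.card - 1)

/-- The affine map on barycentric coordinates determined by positions `pos : W → (U → ℝ)`
of the vertices. -/
noncomputable def affineExt {W U : Type} (pos : W → U → ℝ) (x : W → ℝ) : U → ℝ :=
  fun u => ∑ᶠ w, x w * pos w u

namespace ASC

theorem ext_faces {V : Type} {K L : ASC V} (h : ∀ s, s ∈ K.faces ↔ s ∈ L.faces) : K = L := by
  cases K; cases L
  congr
  exact Set.ext h

/-- The stellar subdivision of `M` at `σ`, with new vertex `a`. -/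
def stellar (M : ASC ℕ) (σ : Finset ℕ) (a : ℕ) : ASC ℕ where
  faces := {t | (a ∉ t ∧ t ∈ M.faces ∧ ¬ σ ⊆ t) ∨
    (a ∈ t ∧ ¬ σ ⊆ t.erase a ∧ t.erase a ∪ σ ∈ M.faces)}
  nonempty_of_mem := by
    rintro t (⟨-, h, -⟩ | ⟨h, -⟩)
    · exact M.nonempty_of_mem h
    · exact ⟨a, h⟩
  down_closed := by
    rintro s t (⟨h1, h2, h3⟩ | ⟨h1, h2, h3⟩) hts hne
    · exact Or.inl ⟨fun h => h1 (hts h), M.down_closed h2 hts hne, fun h => h3 (h.trans hts)⟩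
    · have hσ : σ.Nonempty := by
        rw [Finset.nonempty_iff_ne_empty]
        rintro rfl
        exact h2 (Finset.empty_subset _)
      by_cases ha : a ∈ t
      · exact Or.inr ⟨ha, fun h => h2 (h.trans (Finset.erase_subset_erase a hts)),
          M.down_closed h3 (Finset.union_subset_union_left (Finset.erase_subset_erase a hts))
            (hσ.mono Finset.subset_union_right)⟩
      · have h4 : t ⊆ s.erase a := fun x hx =>
          Finset.mem_erase.2 ⟨fun h => ha (h ▸ hx), hts hx⟩
        exact Or.inl ⟨ha, M.down_closed h3 (h4.trans Finset.subset_union_left) hne,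
          fun h => h2 (h.trans h4)⟩

/-- The cone on `L` with apex `c`. -/
def cone (c : ℕ) (L : ASC ℕ) : ASC ℕ where
  faces := {t | t.Nonempty ∧ (t.erase c = ∅ ∨ t.erase c ∈ L.faces)}
  nonempty_of_mem := fun _ h => h.1
  down_closed := by
    rintro s t ⟨-, h⟩ hts hne
    refine ⟨hne, ?_⟩
    have h4 := Finset.erase_subset_erase c hts
    rcases h with h | h
    · left; rw [h] at h4; exact Finset.subset_empty.1 h4
    · rcases (t.erase c).eq_empty_or_nonempty with h5 | h5
      · exact Or.inl h5
      · exact Or.inr (L.down_closed h h4 h5)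

/-- The union of `E` with the join of `C` and the complex of proper subsets of `σ`. -/
def glue (E : ASC ℕ) (σ : Finset ℕ) (C : ASC ℕ) : ASC ℕ where
  faces := {t | t.Nonempty ∧ (t ∈ E.faces ∨
    ∃ τ s, τ ⊂ σ ∧ (s = ∅ ∨ s ∈ C.faces) ∧ t = τ ∪ s)}
  nonempty_of_mem := fun _ h => h.1
  down_closed := by
    rintro s t ⟨-, h⟩ hts hne
    refine ⟨hne, ?_⟩
    rcases h with h | ⟨τ, u, h1, h2, rfl⟩
    · exact Or.inl (E.down_closed h hts hne)
    · refine Or.inr ⟨t ∩ τ, t ∩ u, Finset.inter_subset_right.trans_ssubset h1, ?_, ?_⟩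
      · rcases (t ∩ u).eq_empty_or_nonempty with h5 | h5
        · exact Or.inl h5
        · rcases h2 with rfl | h2
          · simp at h5
          · exact Or.inr (C.down_closed h2 Finset.inter_subset_right h5)
      · rw [← Finset.inter_union_distrib_left]
        exact (Finset.inter_eq_left.2 hts).symm

theorem stellar_glue {E C : ASC ℕ} {σ ρ : Finset ℕ} {a : ℕ} (hρ : ρ ∈ C.faces)
    (hρE : ρ ∉ E.faces) (hdis : ∀ τ ⊂ σ, ∀ s ∈ C.faces, Disjoint τ s)
    (haE : ∀ s ∈ E.faces, a ∉ s) (haσ : ∀ τ ⊂ σ, a ∉ τ) :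
    stellar (glue E σ C) ρ a = glue E σ (stellar C ρ a) := by
  have hne := C.nonempty_of_mem hρ
  have key : ∀ t ∈ E.faces, ¬ ρ ⊆ t := fun t ht h => hρE (E.down_closed ht h hne)
  have hnd : ∀ τ ⊂ σ, ¬ ρ ⊆ τ := fun τ hτ h => by
    obtain ⟨x, hx⟩ := hne
    exact Finset.disjoint_left.1 (hdis τ hτ ρ hρ) (h hx) hx
  apply ext_faces
  intro t
  constructor
  · rintro (⟨h1, ⟨h2, h3⟩, h4⟩ | ⟨h1, h2, h3, h4⟩)
    · refine ⟨h2, ?_⟩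
      rcases h3 with h3 | ⟨τ, s, h5, h6, rfl⟩
      · exact Or.inl h3
      · refine Or.inr ⟨τ, s, h5, ?_, rfl⟩
        rcases h6 with h6 | h6
        · exact Or.inl h6
        · exact Or.inr (Or.inl ⟨fun h => h1 (Finset.mem_union_right _ h), h6,
            fun h => h4 (h.trans Finset.subset_union_right)⟩)
    · refine ⟨⟨a, h1⟩, ?_⟩
      rcases h4 with h4 | ⟨τ, s, h5, h6, h7⟩
      · exact (key _ h4 Finset.subset_union_right).elim
      · rcases h6 with rfl | h6
        · exfalso
          apply hnd τ h5
          rw [Finset.union_empty] at h7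
          rw [← h7]; exact Finset.subset_union_right
        · have h8 := Finset.disjoint_left.1 (hdis τ h5 s h6)
          have h9 := Finset.disjoint_left.1 (hdis τ h5 ρ hρ)
          have h10 := haσ τ h5
          have h7' : ∀ x, ((x ≠ a ∧ x ∈ t) ∨ x ∈ ρ) ↔ (x ∈ τ ∨ x ∈ s) := by
            intro x
            simpa using Finset.ext_iff.1 h7 x
          refine Or.inr ⟨τ, t \ τ, h5, Or.inr (Or.inr ⟨?_, ?_, ?_⟩), ?_⟩
          · simp [h1, h10]
          · intro h
            apply h2
            intro x hx
            have := h hx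
            simp at this ⊢
            tauto
          · have : (t \ τ).erase a ∪ ρ = s := by
              ext x
              have := h7' x
              have := @h8 x
              have := @h9 x
              simp
              tauto
            rw [this]; exact h6
          · ext x
            have := h7' x
            have := @h9 x
            have : x = a → x ∉ τ := fun h => h ▸ h10
            have : x = a → x ∈ t := fun h => h ▸ h1
            simp
            tauto
  · rintro ⟨h1, h2 | ⟨τ, s, h2, h3, rfl⟩⟩
    · exact Or.inl ⟨haE t h2, ⟨h1, Or.inl h2⟩, key t h2⟩
    · have h4 := haσ τ h2
      rcases h3 with rfl | ⟨h5, h6, h7⟩ | ⟨h5, h6, h7⟩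
      · exact Or.inl ⟨by simpa using h4, ⟨h1, Or.inr ⟨τ, ∅, h2, Or.inl rfl, rfl⟩⟩,
          by simpa using hnd τ h2⟩
      · refine Or.inl ⟨by simp [h4, h5], ⟨h1, Or.inr ⟨τ, s, h2, Or.inr h6, rfl⟩⟩, ?_⟩
        intro h
        apply h7
        intro x hx
        rcases Finset.mem_union.1 (h hx) with h8 | h8
        · exact (Finset.disjoint_left.1 (hdis τ h2 ρ hρ) h8 hx).elim
        · exact h8
      · refine Or.inr ⟨by simp [h5], ?_, ?_, ?_⟩
        · intro h
          apply h6
          intro x hx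
          have h9 := h hx
          have : x ∈ τ → x ∉ ρ := fun h => Finset.disjoint_left.1 (hdis τ h2 ρ hρ) h
          simp at h9 ⊢
          tauto
        · exact hne.mono Finset.subset_union_right
        · refine Or.inr ⟨τ, s.erase a ∪ ρ, h2, Or.inr h7, ?_⟩
          ext x
          have : x = a → x ∉ τ := fun h => h ▸ h4
          simp
          tauto

/-- `Sub Z A M M'`: `M'` arises from `M` by iterated stellar subdivisions at simplices outside
`Z`, with new vertices outside `A`. -/
inductive Sub (Z : Set (Finset ℕ)) (A : Finset ℕ) (M : ASC ℕ) : ASC ℕ → Prop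
  | refl : Sub Z A M M
  | step {N : ASC ℕ} {σ : Finset ℕ} {a : ℕ} : Sub Z A M N → σ ∈ N.faces → σ ∉ Z → a ∉ A →
      {a} ∉ N.faces → Sub Z A M (stellar N σ a)

namespace Sub

variable {Z Z' : Set (Finset ℕ)} {A B : Finset ℕ} {M N P : ASC ℕ}

theorem mono (h : Sub Z A M N) (hBA : B ⊆ A) : Sub Z B M N := by
  induction h with
  | refl => exact .refl
  | step _ h1 h2 h3 h4 ih => exact .step ih h1 h2 (fun h => h3 (hBA h)) h4

theorem trans (h : Sub Z A M N) (h' : Sub Z A N P) : Sub Z A M P := by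
  induction h' with
  | refl => exact h
  | step _ h1 h2 h3 h4 ih => exact .step ih h1 h2 h3 h4

theorem not_mem_of_singleton {a : ℕ} (h : {a} ∉ N.faces) {s : Finset ℕ} (hs : s ∈ N.faces) :
    a ∉ s := fun ha => h (N.down_closed hs (Finset.singleton_subset_iff.2 ha) ⟨a, by simp⟩)

theorem card_le (h : Sub Z A M N) {d : ℕ} (hM : ∀ s ∈ M.faces, s.card ≤ d) :
    ∀ s ∈ N.faces, s.card ≤ d := by
  induction h with
  | refl => exact hM
  | @step N σ a _ h1 h2 h3 h4 ih =>
    rintro s (⟨h5, h6, h7⟩ | ⟨h5, h6, h7⟩)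
    · exact ih s h6
    · have h8 := ih _ h7
      have h9 : s.erase a ⊂ s.erase a ∪ σ :=
        Finset.ssubset_iff_subset_ne.2 ⟨Finset.subset_union_left, fun h => h6 (by
          rw [h]; exact Finset.subset_union_right)⟩
      have := Finset.card_lt_card h9
      rw [Finset.card_erase_of_mem h5] at this
      omega

theorem stellar_finite {σ : Finset ℕ} {a : ℕ} (hN : N.faces.Finite) :
    (stellar N σ a).faces.Finite := by
  classical
  have hfin : (⋃ s ∈ N.faces, ((insert a s).powerset : Set (Finset ℕ))).Finite :=
    hN.biUnion fun s _ => Finset.finite_toSet _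
  refine hfin.subset ?_
  rintro s (⟨h5, h6, h7⟩ | ⟨h5, h6, h7⟩)
  · exact Set.mem_biUnion h6 (by simp)
  · refine Set.mem_biUnion h7 ?_
    simp only [Finset.coe_powerset, Set.mem_preimage, Set.mem_powerset_iff, Finset.coe_subset]
    intro x hx
    by_cases hxa : x = a <;> simp [hxa, hx]

theorem finite (h : Sub Z A M N) (hM : M.faces.Finite) : N.faces.Finite := by
  induction h with
  | refl => exact hM
  | step _ h1 h2 h3 h4 ih => exact stellar_finite ih

/-- Faces with all vertices in `A` do not change, except that those outside `Z` may disappear. -/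
theorem mem_of_subset (h : Sub Z A M N) : ∀ s ∈ N.faces, s ⊆ A → s ∈ M.faces := by
  induction h with
  | refl => exact fun s hs _ => hs
  | step _ h1 h2 h3 h4 ih =>
    rintro s (⟨h5, h6, h7⟩ | ⟨h5, h6, h7⟩) hsA
    · exact ih s h6 hsA
    · exact (h3 (hsA h5)).elim

theorem le {E : ASC ℕ} (h : Sub E.faces A M N) (hE : E.faces ⊆ M.faces) : E.faces ⊆ N.faces := by
  induction h with
  | refl => exact hE
  | @step N σ a _ h1 h2 h3 h4 ih =>
    intro s hs
    exact Or.inl ⟨not_mem_of_singleton h4 (ih hs), ih hs,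
      fun h => h2 (E.down_closed hs h (N.nonempty_of_mem h1))⟩

theorem glue_aux {E C C' : ASC ℕ} {σ : Finset ℕ} (h : Sub Z A C C')
    (hEC : ∀ s ∈ C.faces, s ∈ E.faces → s ∈ Z)
    (hdis : ∀ τ ⊂ σ, ∀ s ∈ C.faces, Disjoint τ s)
    (hEA : ∀ s ∈ E.faces, s ⊆ A) (hσA : ∀ τ ⊂ σ, τ ⊆ A) :
    (∀ s ∈ C'.faces, s ∈ E.faces → s ∈ Z) ∧ (∀ τ ⊂ σ, ∀ s ∈ C'.faces, Disjoint τ s) := by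
  induction h with
  | refl => exact ⟨hEC, hdis⟩
  | @step N ρ a _ h1 h2 h3 h4 ih =>
    constructor
    · rintro s (⟨h5, h6, h7⟩ | ⟨h5, h6, h7⟩) hsE
      · exact ih.1 s h6 hsE
      · exact (h3 (hEA s hsE h5)).elim
    · rintro τ hτ s (⟨h5, h6, h7⟩ | ⟨h5, h6, h7⟩)
      · exact ih.2 τ hτ s h6
      · have h8 := ih.2 τ hτ _ h7
        rw [Finset.disjoint_left] at h8 ⊢
        intro x hx hxs
        have hxa : x ≠ a := fun h => h3 (hσA τ hτ (h ▸ hx))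
        exact h8 hx (by simp [hxa, hxs])

theorem glue_singleton {E C : ASC ℕ} {σ : Finset ℕ} {a : ℕ} (hC : {a} ∉ C.faces)
    (hEA : ∀ s ∈ E.faces, s ⊆ A) (hσA : ∀ τ ⊂ σ, τ ⊆ A) (ha : a ∉ A) :
    {a} ∉ (glue E σ C).faces := by
  rintro ⟨-, h | ⟨τ, s, h1, h2, h3⟩⟩
  · exact ha (hEA _ h (by simp))
  · have h4 : a ∈ τ ∪ s := by rw [← h3]; simp
    rcases Finset.mem_union.1 h4 with h5 | h5
    · exact ha (hσA τ h1 h5)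
    · rcases h2 with rfl | h2
      · simp at h5
      · exact not_mem_of_singleton hC h2 h5

theorem mem_glue {E C : ASC ℕ} {σ s : Finset ℕ} (hσ : σ.Nonempty) (hs : s ∈ C.faces) :
    s ∈ (glue E σ C).faces :=
  ⟨C.nonempty_of_mem hs, Or.inr ⟨∅, s, Finset.empty_ssubset.2 hσ, Or.inr hs, by simp⟩⟩

theorem glue_glue {E C C' : ASC ℕ} {σ : Finset ℕ} (hσ : σ.Nonempty) (h : Sub Z A C C')
    (hEC : ∀ s ∈ C.faces, s ∈ E.faces → s ∈ Z)
    (hdis : ∀ τ ⊂ σ, ∀ s ∈ C.faces, Disjoint τ s)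
    (hEA : ∀ s ∈ E.faces, s ⊆ A) (hσA : ∀ τ ⊂ σ, τ ⊆ A) (hZ' : Z' ⊆ E.faces) :
    Sub Z' A (glue E σ C) (glue E σ C') := by
  induction h with
  | refl => exact .refl
  | @step N ρ a h0 h1 h2 h3 h4 ih =>
    obtain ⟨h5, h6⟩ := h0.glue_aux hEC hdis hEA hσA
    have hρE : ρ ∉ E.faces := fun h => h2 (h5 ρ h1 h)
    rw [← stellar_glue h1 hρE h6 (fun s hs h => h3 (hEA s hs h)) fun τ hτ h => h3 (hσA τ hτ h)]
    exact .step ih (mem_glue hσ h1) (fun h => hρE (hZ' h)) h3 (glue_singleton h4 hEA hσA h3)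

end Sub

end ASC

namespace ASC

variable {V : Type} [DecidableEq V]

/-- `Mv K Z A (M, ψ) (M', ψ')`: the labelled complex `(M', ψ')` arises from `(M, ψ)` by iterated
labelled stellar subdivisions and relabellings, all of them fixed on `Z` and changing the
realized map to a contiguous one. -/
inductive Mv (K : ASC V) (Z : ASC ℕ) (A : Finset ℕ) (M : ASC ℕ) (ψ : ℕ → V) :
    ASC ℕ → (ℕ → V) → Prop
  | refl : Mv K Z A M ψ M ψ
  | step {N : ASC ℕ} {χ : ℕ → V} {σ : Finset ℕ} {a : ℕ} : Mv K Z A M ψ N χ → σ ∈ N.faces →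
      σ ∉ Z.faces → a ∉ A → {a} ∉ N.faces →
      (∀ t ∈ N.faces, σ ⊆ t → insert (χ a) (t.image χ) ∈ K.faces) →
      Mv K Z A M ψ (stellar N σ a) χ
  | relabel {N : ASC ℕ} {χ χ' : ℕ → V} : Mv K Z A M ψ N χ →
      (∀ s ∈ Z.faces, ∀ w ∈ s, χ' w = χ w) →
      (∀ t ∈ N.faces, t.image χ ∪ t.image χ' ∈ K.faces) → Mv K Z A M ψ N χ'

namespace Mv

variable {K : ASC V} {Z : ASC ℕ} {A : Finset ℕ} {M N P : ASC ℕ} {ψ χ θ : ℕ → V}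

theorem sub (h : Mv K Z A M ψ N χ) : Sub Z.faces A M N := by
  induction h with
  | refl => exact .refl
  | step _ h1 h2 h3 h4 _ ih => exact .step ih h1 h2 h3 h4
  | relabel _ _ _ ih => exact ih

theorem mono {B : Finset ℕ} (h : Mv K Z A M ψ N χ) (hBA : B ⊆ A) : Mv K Z B M ψ N χ := by
  induction h with
  | refl => exact .refl
  | step _ h1 h2 h3 h4 h5 ih => exact .step ih h1 h2 (fun h => h3 (hBA h)) h4 h5
  | relabel _ h1 h2 ih => exact .relabel ih h1 h2

theorem trans (h : Mv K Z A M ψ N χ) (h' : Mv K Z A N χ P θ) : Mv K Z A M ψ P θ := by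
  induction h' with
  | refl => exact h
  | step _ h1 h2 h3 h4 h5 ih => exact .step ih h1 h2 h3 h4 h5
  | relabel _ h1 h2 ih => exact .relabel ih h1 h2

theorem stellar_simplicial {σ : Finset ℕ} {a : ℕ} (hN : N.IsSimplicial K χ)
    (h : ∀ t ∈ N.faces, σ ⊆ t → insert (χ a) (t.image χ) ∈ K.faces) :
    (stellar N σ a).IsSimplicial K χ := by
  rintro t (⟨h5, h6, h7⟩ | ⟨h5, h6, h7⟩)
  · exact hN t h6
  · refine K.down_closed (h _ h7 Finset.subset_union_right) ?_ ⟨χ a, Finset.mem_image_of_mem _ h5⟩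
    intro x hx
    obtain ⟨y, hy, rfl⟩ := Finset.mem_image.1 hx
    by_cases hya : y = a
    · simp [hya]
    · exact Finset.mem_insert_of_mem (Finset.mem_image_of_mem _ (by simp [hya, hy]))

theorem simplicial (h : Mv K Z A M ψ N χ) (hM : M.IsSimplicial K ψ) : N.IsSimplicial K χ := by
  induction h with
  | refl => exact hM
  | step _ h1 h2 h3 h4 h5 ih => exact stellar_simplicial ih h5
  | relabel _ h1 h2 ih =>
    intro t ht
    exact K.down_closed (h2 t ht) Finset.subset_union_right
      (Finset.Nonempty.image (ASC.nonempty_of_mem _ ht) _)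

end Mv

/-- Subdivisions of the second factor of a `glue` carry any labelling which is constant on the
new vertices. -/
theorem Sub.mv_glue {K : ASC V} {Z L : ASC ℕ} {A : Finset ℕ} {E C C' : ASC ℕ} {σ : Finset ℕ}
    {χ : ℕ → V} {v : V} (hσ : σ.Nonempty) (h : Sub L.faces A C C')
    (hEC : ∀ s ∈ C.faces, s ∈ E.faces → s ∈ L.faces)
    (hCL : ∀ s ∈ C.faces, s ⊆ A → s ∈ L.faces)
    (hdis : ∀ τ ⊂ σ, ∀ s ∈ C.faces, Disjoint τ s)
    (hEA : ∀ s ∈ E.faces, s ⊆ A) (hσA : ∀ τ ⊂ σ, τ ⊆ A) (hZE : Z.faces ⊆ E.faces)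
    (hχ : ∀ w ∉ A, χ w = v) (hsimp : (glue E σ C).IsSimplicial K χ) :
    Mv K Z A (glue E σ C) χ (glue E σ C') χ := by
  induction h with
  | refl => exact .refl
  | @step N ρ a h0 h1 h2 h3 h4 ih =>
    obtain ⟨h5, h6⟩ := h0.glue_aux hEC hdis hEA hσA
    have hρE : ρ ∉ E.faces := fun h => h2 (h5 ρ h1 h)
    rw [← stellar_glue h1 hρE h6 (fun s hs h => h3 (hEA s hs h)) fun τ hτ h => h3 (hσA τ hτ h)]
    refine .step ih (mem_glue hσ h1) (fun h => hρE (hZE h)) h3 (glue_singleton h4 hEA hσA h3) ?_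
    intro t ht hρt
    have hρA : ¬ ρ ⊆ A := fun h => h2 (hCL ρ (h0.mem_of_subset ρ h1 h) h)
    obtain ⟨w, hw, hwA⟩ := Finset.not_subset.1 hρA
    rw [Finset.insert_eq_of_mem]
    · exact ih.simplicial hsimp t ht
    · rw [hχ a h3, ← hχ w hwA]
      exact Finset.mem_image_of_mem _ (hρt hw)

theorem link_link {K : ASC V} {s t : Finset V} (ht : t ∈ (K.link s).faces) :
    (K.link s).link t = K.link (s ∪ t) := by
  obtain ⟨h1, h2, h3⟩ := ht
  apply ext_faces
  intro u
  constructor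
  · rintro ⟨⟨h4, h5, h6⟩, h7, ⟨h8, h9, h10⟩⟩
    exact ⟨h4, Finset.disjoint_union_left.2 ⟨h5, h7⟩, by rwa [Finset.union_assoc]⟩
  · rintro ⟨h4, h5, h6⟩
    rw [Finset.disjoint_union_left] at h5
    rw [Finset.union_assoc] at h6
    have hu := K.nonempty_of_mem h4
    have hsu : (s ∪ u) ∈ K.faces := K.down_closed h6
      (Finset.union_subset_union_right Finset.subset_union_right)
      (hu.mono Finset.subset_union_right)
    have htu : (t ∪ u) ∈ K.faces := K.down_closed h6 Finset.subset_union_right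
      (hu.mono Finset.subset_union_right)
    exact ⟨⟨h4, h5.1, hsu⟩, h5.2, htu, Finset.disjoint_union_right.2 ⟨h2, h5.1⟩, h6⟩

theorem _root_.WCM.link {K : ASC V} {n : ℤ} (hK : WCM K n) {s : Finset V} (hs : s ∈ K.faces) :
    WCM (K.link s) (n - s.card) := by
  refine ⟨hK.2 s hs, fun t ht => ?_⟩
  rw [link_link ht]
  have := hK.2 _ ht.2.2
  rw [Finset.card_union_of_disjoint ht.2.1] at this
  push_cast at this
  rwa [← sub_sub n] at this

/-- The subcomplex of faces not containing `σ`. -/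
def avoid (M : ASC ℕ) (σ : Finset ℕ) : ASC ℕ where
  faces := {t | t ∈ M.faces ∧ ¬ σ ⊆ t}
  nonempty_of_mem := fun _ h => M.nonempty_of_mem h.1
  down_closed := fun _ _ h hts hne => ⟨M.down_closed h.1 hts hne, fun h' => h.2 (h'.trans hts)⟩

theorem stellar_eq_glue {M : ASC ℕ} {σ : Finset ℕ} {c : ℕ} (hσ : σ ∈ M.faces)
    (hc : ∀ s ∈ M.faces, c ∉ s) :
    stellar M σ c = glue (avoid M σ) σ (cone c (M.link σ)) := by
  have hcσ := hc σ hσ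
  have hne := M.nonempty_of_mem hσ
  apply ext_faces
  intro t
  constructor
  · rintro (⟨h5, h6, h7⟩ | ⟨h5, h6, h7⟩)
    · exact ⟨M.nonempty_of_mem h6, Or.inl ⟨h6, h7⟩⟩
    · refine ⟨⟨c, h5⟩, Or.inr ⟨t ∩ σ, t \ σ, ?_, Or.inr ⟨⟨c, by simp [h5, hcσ]⟩, ?_⟩, ?_⟩⟩
      · refine Finset.ssubset_iff_subset_ne.2 ⟨Finset.inter_subset_right, fun h => h6 ?_⟩
        intro x hx
        have : x ∈ t := Finset.mem_of_mem_inter_left (h.symm ▸ hx : x ∈ t ∩ σ)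
        simp only [Finset.mem_erase]
        exact ⟨fun h => hcσ (h ▸ hx), this⟩
      · rcases ((t \ σ).erase c).eq_empty_or_nonempty with h8 | h8
        · exact Or.inl h8
        · refine Or.inr ⟨M.down_closed h7 ?_ h8, ?_, ?_⟩
          · intro x; simp; tauto
          · rw [Finset.disjoint_left]; intro x; simp; tauto
          · convert h7 using 1
            ext x; simp; tauto
      · ext x; simp; tauto
  · rintro ⟨h1, ⟨h2, h3⟩ | ⟨τ, s, h2, h3, rfl⟩⟩
    · exact Or.inl ⟨hc t h2, h2, h3⟩
    · have hcτ : c ∉ τ := fun h => hcσ (h2.1 h)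
      have hsτ : ¬ σ ⊆ τ := h2.2
      have hss := h2.1
      rcases h3 with rfl | ⟨h4, h5⟩
      · rw [Finset.union_empty] at h1 ⊢
        exact Or.inl ⟨hcτ, M.down_closed hσ hss h1, hsτ⟩
      · have hds : ∀ x ∈ σ, x ∉ s := by
          intro x hx hxs
          have hxc : x ≠ c := fun h => hcσ (h ▸ hx)
          have hxs' : x ∈ s.erase c := by simp [hxc, hxs]
          rcases h5 with h5 | ⟨h5, h6, h7⟩
          · simp [h5] at hxs'
          · exact Finset.disjoint_left.1 h6 hx hxs'
        have hns : ¬ σ ⊆ τ ∪ s := by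
          intro h
          apply hsτ
          intro x hx
          have := h hx
          simp [hds x hx] at this
          exact this
        by_cases hcs : c ∈ s
        · refine Or.inr ⟨by simp [hcs], fun h => hns (h.trans (Finset.erase_subset _ _)), ?_⟩
          have : (τ ∪ s).erase c ∪ σ = σ ∪ s.erase c := by
            ext x
            have : x = c → x ∉ τ := fun h => h ▸ hcτ
            have := @hss x
            simp; tauto
          rw [this]
          rcases h5 with h5 | ⟨h5, h6, h7⟩
          · simpa [h5] using hσ
          · exact h7
        · refine Or.inl ⟨by simp [hcs, hcτ], ?_, hns⟩
          rw [Finset.erase_eq_of_notMem hcs] at h5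
          rcases h5 with h5 | ⟨h5, h6, h7⟩
          · simp [h5] at h4
          · exact M.down_closed h7 (Finset.union_subset_union_left hss) h1

/-- The map `ψ`, simplicial on `L`, extends to a simplicial map on a subdivision, relative to `L`,
of the cone on `L`. -/
def Fillable (K : ASC V) (A : Finset ℕ) (c : ℕ) (L : ASC ℕ) (ψ : ℕ → V) : Prop :=
  ∃ C χ, Sub L.faces A (cone c L) C ∧ C.IsSimplicial K χ ∧ ∀ w ∈ A, χ w = ψ w

/-- The combinatorial form of connectivity: every simplicial map from a finite complex of
dimension at most `d` is fillable. -/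
def FillConn (K : ASC V) (d : ℤ) : Prop :=
  ∀ (A : Finset ℕ) (c : ℕ) (L : ASC ℕ) (ψ : ℕ → V), c ∉ A → L.faces.Finite →
    (∀ s ∈ L.faces, s ⊆ A) → (∀ s ∈ L.faces, (s.card : ℤ) ≤ d + 1) → L.IsSimplicial K ψ →
    Fillable K A c L ψ

/-- The faces outside `Z` in which every vertex shares its label with another vertex. -/
def badSet (Y Z : ASC ℕ) (ψ : ℕ → V) : Set (Finset ℕ) :=
  {s | s ∈ Y.faces ∧ s ∉ Z.faces ∧ ∀ v ∈ s, ∃ w ∈ s, w ≠ v ∧ ψ w = ψ v}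

theorem card_image_lt_of_bad {ψ : ℕ → V} {s : Finset ℕ} (hne : s.Nonempty)
    (h : ∀ v ∈ s, ∃ w ∈ s, w ≠ v ∧ ψ w = ψ v) : (s.image ψ).card + 1 ≤ s.card := by
  refine Nat.lt_of_le_of_ne Finset.card_image_le fun h' => ?_
  have hinj := Finset.card_image_iff.1 h'
  obtain ⟨v, hv⟩ := hne
  obtain ⟨w, hw, hwv, he⟩ := h v hv
  exact hwv (hinj hw hv he)

/-- Removing one bad simplex of maximal dimension. -/
theorem exists_mv_badSet_ssubset {n : ℕ} {K : ASC V} (hK : WCM K (n : ℤ))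
    (hfill : ∀ s ∈ K.faces, s.card ≤ n → FillConn (K.link s) (n - s.card - 1))
    (IH : ∀ m < n, ∀ K : ASC V, WCM K (m : ℤ) → ∀ (Y Z : ASC ℕ) (ψ : ℕ → V) (A : Finset ℕ),
      Y.faces.Finite → (∀ s ∈ Y.faces, s ⊆ A) → (∀ s ∈ Y.faces, s.card ≤ m + 1) →
      Z.faces ⊆ Y.faces → Y.IsSimplicial K ψ →
      ∃ Y' ψ', Mv K Z A Y ψ Y' ψ' ∧ (∀ w ∈ A, ψ' w = ψ w) ∧
        ∀ s ∈ Y'.faces, ∀ w ∈ s, ∀ w' ∈ s, ψ' w = ψ' w' → w = w' ∨ {w, w'} ∈ Z.faces)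
    {Y Z : ASC ℕ} {ψ : ℕ → V} {A : Finset ℕ} (hfin : Y.faces.Finite)
    (hYA : ∀ s ∈ Y.faces, s ⊆ A) (hdim : ∀ s ∈ Y.faces, s.card ≤ n + 1)
    (hZY : Z.faces ⊆ Y.faces) (hψ : Y.IsSimplicial K ψ) (hbad : (badSet Y Z ψ).Nonempty) :
    ∃ Y' ψ', Mv K Z A Y ψ Y' ψ' ∧ (∀ w ∈ A, ψ' w = ψ w) ∧
      badSet Y' Z ψ' ⊂ badSet Y Z ψ := by
  have hbfin : (badSet Y Z ψ).Finite := hfin.subset fun _ h => h.1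
  obtain ⟨σ, ⟨hσY, hσZ, hσb⟩, hσmax⟩ :=
    Set.exists_max_image (badSet Y Z ψ) Finset.card hbfin hbad
  have hne := Y.nonempty_of_mem hσY
  have hcard := card_image_lt_of_bad hne hσb
  have hσdim := hdim σ hσY
  set κ := σ.image ψ with hκ
  have hκK : κ ∈ K.faces := hψ σ hσY
  have hκne : κ.Nonempty := hne.image _
  have hκpos := hκne.card_pos
  obtain ⟨v, hv⟩ := hκne
  set L := Y.link σ with hL
  have hLY : ∀ s ∈ L.faces, s ∈ Y.faces := fun s h => h.1
  -- the link of `σ` is mapped to the link of `κ`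
  have hLκ : L.IsSimplicial (K.link κ) ψ := by
    rintro s ⟨h1, h2, h3⟩
    refine ⟨hψ s h1, ?_, by rw [← Finset.image_union]; exact hψ _ h3⟩
    rw [Finset.disjoint_left]
    intro x hx hxs
    obtain ⟨p, hp, rfl⟩ := Finset.mem_image.1 hx
    obtain ⟨u, hu, hup⟩ := Finset.mem_image.1 hxs
    have huσ : u ∉ σ := fun h => Finset.disjoint_left.1 h2 h hu
    have hmem : insert u σ ∈ badSet Y Z ψ := by
      have hins : insert u σ ∈ Y.faces := Y.down_closed h3 (by
        intro y hy
        rcases Finset.mem_insert.1 hy with rfl | hy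
        · exact Finset.mem_union_right _ hu
        · exact Finset.mem_union_left _ hy) ⟨u, by simp⟩
      refine ⟨hins, fun h => hσZ (Z.down_closed h (Finset.subset_insert _ _) hne), ?_⟩
      intro y hy
      rcases Finset.mem_insert.1 hy with rfl | hy
      · exact ⟨p, Finset.mem_insert_of_mem hp, fun h => huσ (h ▸ hp), hup.symm⟩
      · obtain ⟨w, hw, h5, h6⟩ := hσb y hy
        exact ⟨w, Finset.mem_insert_of_mem hw, h5, h6⟩
    have := hσmax _ hmem
    rw [Finset.card_insert_of_notMem huσ] at this
    omega
  have hLdim : ∀ s ∈ L.faces, s.card + σ.card ≤ n + 1 := by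
    rintro s ⟨h1, h2, h3⟩
    have := hdim _ h3
    rw [Finset.card_union_of_disjoint h2] at this
    omega
  have hLfin : L.faces.Finite := hfin.subset fun s h => h.1
  obtain ⟨c, hcA⟩ := Infinite.exists_notMem_finset A
  obtain ⟨C₁, ψ₁, hC₁, hψ₁, hψ₁A⟩ := hfill κ hκK (by omega) A c L ψ hcA hLfin
    (fun s hs => hYA s (hLY s hs))
    (fun s hs => by have := hLdim s hs; omega) hLκ
  have hm : n - κ.card < n := by omega
  have hK' : WCM (K.link κ) ((n - κ.card : ℕ) : ℤ) := by
    rw [Nat.cast_sub (by omega)]; exact hK.link hκK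
  have hconefin : (cone c L).faces.Finite := by
    have hfin' : ((⋃ s ∈ L.faces, ((insert c s).powerset : Set (Finset ℕ))) ∪ {{c}}).Finite :=
      (hLfin.biUnion fun s _ => Finset.finite_toSet _).union (Set.finite_singleton _)
    refine hfin'.subset ?_
    rintro s ⟨h1, h2 | h2⟩
    · right
      rw [Finset.erase_eq_empty_iff] at h2
      rcases h2 with h2 | h2
      · simp [h2] at h1
      · simpa using h2
    · left
      refine Set.mem_biUnion h2 ?_
      simp only [Finset.coe_powerset, Set.mem_preimage, Set.mem_powerset_iff, Finset.coe_subset]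
      intro x hx
      by_cases hxa : x = c <;> simp [hxa, hx]
  have hconedim : ∀ s ∈ (cone c L).faces, s.card ≤ n - κ.card + 1 := by
    rintro s ⟨h1, h2⟩
    have h3 : s.card ≤ (s.erase c).card + 1 := by
      have := Finset.pred_card_le_card_erase (s := s) (a := c)
      omega
    rcases h2 with h2 | h2
    · rw [h2] at h3; simp at h3; omega
    · have := hLdim _ h2
      omega
  have hcL : ∀ s ∈ L.faces, c ∉ s := fun s hs h => hcA (hYA s (hLY s hs) h)
  have hLcone : L.faces ⊆ (cone c L).faces := fun s hs =>
    ⟨L.nonempty_of_mem hs, Or.inr (by rwa [Finset.erase_eq_of_notMem (hcL s hs)])⟩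
  have hC₁fin := hC₁.finite hconefin
  obtain ⟨B, hB⟩ : ∃ B : Finset ℕ, ∀ s ∈ C₁.faces, s ⊆ B := by
    refine ⟨hC₁fin.toFinset.biUnion id, fun s hs => ?_⟩
    exact Finset.subset_biUnion_of_mem id (hC₁fin.mem_toFinset.2 hs)
  obtain ⟨C₂, ψ₂, hC₂, hψ₂B, hinj⟩ := IH _ hm (K.link κ) hK' C₁ L ψ₁ (A ∪ B) hC₁fin
    (fun s hs => (hB s hs).trans Finset.subset_union_right) (hC₁.card_le hconedim)
    (hC₁.le hLcone) hψ₁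
  have hψ₂A : ∀ w ∈ A, ψ₂ w = ψ w := fun w hw => by
    rw [hψ₂B w (Finset.mem_union_left _ hw), hψ₁A w hw]
  have hψ₂ := hC₂.simplicial hψ₁
  have hsub : Sub L.faces A (cone c L) C₂ := hC₁.trans (hC₂.sub.mono Finset.subset_union_left)
  -- auxiliary labelling, constant on the new vertices
  let χ : ℕ → V := fun w => if w ∈ A then ψ w else v
  have hχA : ∀ w ∈ A, χ w = ψ w := fun w hw => by simp [χ, hw]
  have hχn : ∀ w ∉ A, χ w = v := fun w hw => by simp [χ, hw]
  have himg : ∀ s ⊆ A, s.image χ = s.image ψ := fun s hs =>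
    Finset.image_congr fun w hw => hχA w (hs hw)
  have hst := stellar_eq_glue hσY fun s hs h => hcA (hYA s hs h)
  have hleg : ∀ t ∈ Y.faces, σ ⊆ t → insert (χ c) (t.image χ) ∈ K.faces := by
    intro t ht hσt
    rw [himg t (hYA t ht), hχn c hcA, Finset.insert_eq_of_mem]
    · exact hψ t ht
    · exact Finset.image_subset_image hσt hv
  have hσA : ∀ τ ⊂ σ, τ ⊆ A := fun τ hτ => hτ.1.trans (hYA σ hσY)
  have m1 : Mv K Z A Y ψ Y χ := .relabel .refl
    (fun s hs w hw => hχA w (hYA s (hZY hs) hw))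
    (fun t ht => by rw [himg t (hYA t ht), Finset.union_self]; exact hψ t ht)
  have m2 : Mv K Z A Y ψ (stellar Y σ c) χ := .step m1 hσY hσZ hcA
    (fun h => hcA (hYA _ h (by simp))) hleg
  have m2s := m2.simplicial hψ
  rw [hst] at m2 m2s
  have hconeL : ∀ s ∈ (cone c L).faces, c ∉ s → s ∈ L.faces := by
    rintro s ⟨h1, h2⟩ h3
    rw [Finset.erase_eq_of_notMem h3] at h2
    rcases h2 with h2 | h2
    · simp [h2] at h1
    · exact h2
  have hEA : ∀ s ∈ (avoid Y σ).faces, s ⊆ A := fun s hs => hYA s hs.1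
  have hconeA : ∀ s ∈ (cone c L).faces, s ⊆ A → s ∈ L.faces :=
    fun s hs h => hconeL s hs fun h' => hcA (h h')
  have hEC : ∀ s ∈ (cone c L).faces, s ∈ (avoid Y σ).faces → s ∈ L.faces :=
    fun s hs h => hconeA s hs (hEA s h)
  have hdis : ∀ τ ⊂ σ, ∀ s ∈ (cone c L).faces, Disjoint τ s := by
    rintro τ hτ s ⟨h1, h2⟩
    rw [Finset.disjoint_left]
    intro x hx hxs
    have hxc : x ≠ c := fun h => hcA (h ▸ hσA τ hτ hx)
    have hxs' : x ∈ s.erase c := by simp [hxc, hxs]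
    rcases h2 with h2 | ⟨-, h3, -⟩
    · simp [h2] at hxs'
    · exact Finset.disjoint_left.1 h3 (hτ.1 hx) hxs'
  have hZE : Z.faces ⊆ (avoid Y σ).faces := fun s hs =>
    ⟨hZY hs, fun h => hσZ (Z.down_closed hs h hne)⟩
  have m3 := m2.trans (hsub.mv_glue hne hEC hconeA hdis hEA hσA hZE hχn m2s)
  have m4 : Mv K Z A Y ψ (glue (avoid Y σ) σ C₂) ψ₂ := by
    refine .relabel m3 ?_ ?_
    · intro s hs w hw
      have hwA := hYA s (hZY hs) hw
      rw [hψ₂A w hwA, hχA w hwA]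
    · rintro t ⟨h1, h2 | ⟨τ, s, h2, h3, rfl⟩⟩
      · have htA := hEA t h2
        have : t.image ψ₂ = t.image ψ := Finset.image_congr fun w hw => hψ₂A w (htA hw)
        rw [himg t htA, this, Finset.union_self]
        exact hψ t h2.1
      · have hbig : κ ∪ s.image ψ₂ ∈ K.faces := by
          rcases h3 with rfl | h3
          · simpa using hκK
          · exact (hψ₂ s h3).2.2
        refine K.down_closed hbig ?_ ((h1.image _).mono Finset.subset_union_left)
        intro x hx
        have hτψ : ∀ w ∈ τ, ψ w ∈ κ := fun w hw => Finset.mem_image_of_mem _ (h2.1 hw)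
        rcases Finset.mem_union.1 hx with hx | hx <;> obtain ⟨w, hw, rfl⟩ := Finset.mem_image.1 hx
        · by_cases hwA : w ∈ A
          · rw [hχA w hwA]
            rcases Finset.mem_union.1 hw with hw | hw
            · exact Finset.mem_union_left _ (hτψ w hw)
            · rw [← hψ₂A w hwA]
              exact Finset.mem_union_right _ (Finset.mem_image_of_mem _ hw)
          · rw [hχn w hwA]
            exact Finset.mem_union_left _ hv
        · rcases Finset.mem_union.1 hw with hw | hw
          · rw [hψ₂A w (hσA τ h2 hw)]
            exact Finset.mem_union_left _ (hτψ w hw)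
          · exact Finset.mem_union_right _ (Finset.mem_image_of_mem _ hw)
  refine ⟨_, _, m4, hψ₂A, ?_⟩
  have hsL : ∀ s ∈ C₂.faces, s ⊆ A → s ∈ L.faces := fun s hs h =>
    hconeA s (hsub.mem_of_subset s hs h) h
  have hbadA : ∀ t ∈ Y.faces, t ∈ badSet (glue (avoid Y σ) σ C₂) Z ψ₂ → t ∈ badSet Y Z ψ := by
    rintro t htY ⟨-, h1, h2⟩
    refine ⟨htY, h1, fun x hx => ?_⟩
    obtain ⟨w, hw, h3, h4⟩ := h2 x hx
    rw [hψ₂A w (hYA t htY hw), hψ₂A x (hYA t htY hx)] at h4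
    exact ⟨w, hw, h3, h4⟩
  rw [Set.ssubset_iff_of_subset]
  · refine ⟨σ, ⟨hσY, hσZ, hσb⟩, ?_⟩
    rintro ⟨⟨-, h2 | ⟨τ, s, h2, h3, h4⟩⟩, -⟩
    · exact h2.2 subset_rfl
    · apply h2.2
      intro x hx
      rw [h4] at hx
      rcases Finset.mem_union.1 hx with hx | hx
      · exact hx
      · exfalso
        have hsσ : s ⊆ σ := by rw [h4]; exact Finset.subset_union_right
        rcases h3 with rfl | h3
        · simp at hx
        · exact Finset.disjoint_left.1 (hsL s h3 (hsσ.trans (hYA σ hσY))).2.1 (hsσ hx) hx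
  · rintro t ⟨⟨h1, h2 | ⟨τ, s, h2, h3, rfl⟩⟩, h4, h5⟩
    · exact hbadA t h2.1 ⟨⟨h1, Or.inl h2⟩, h4, h5⟩
    · have htg : τ ∪ s ∈ badSet (glue (avoid Y σ) σ C₂) Z ψ₂ :=
        ⟨⟨h1, Or.inr ⟨τ, s, h2, h3, rfl⟩⟩, h4, h5⟩
      rcases h3 with rfl | h3
      · rw [Finset.union_empty] at htg h1
        rw [Finset.union_empty]
        exact hbadA τ (Y.down_closed hσY h2.1 h1) htg
      · by_cases hsA : s ⊆ A
        · exact hbadA _ (Y.down_closed (hsL s h3 hsA).2.2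
            (Finset.union_subset_union_left h2.1) h1) htg
        · exfalso
          obtain ⟨a, has, haA⟩ := Finset.not_subset.1 hsA
          obtain ⟨w, hw, hwa, he⟩ := h5 a (Finset.mem_union_right _ has)
          rcases Finset.mem_union.1 hw with hw | hw
          · refine Finset.disjoint_left.1 (hψ₂ s h3).2.1 ?_ (Finset.mem_image_of_mem _ has)
            rw [← he, hψ₂A w (hσA τ h2 hw)]
            exact Finset.mem_image_of_mem _ (h2.1 hw)
          · rcases hinj s h3 a has w hw he.symm with h6 | h6
            · exact hwa h6.symm
            · exact haA (hYA _ (hLY _ h6) (by simp))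

/-- The combinatorial form of simplexwise injective approximation. -/
theorem exists_mv_injective
    (hfill : ∀ (K : ASC V) (d : ℤ), -1 ≤ d → IsConn (↥K.space) d → FillConn K d) (n : ℕ) :
    ∀ K : ASC V, WCM K (n : ℤ) → ∀ (Y Z : ASC ℕ) (ψ : ℕ → V) (A : Finset ℕ),
      Y.faces.Finite → (∀ s ∈ Y.faces, s ⊆ A) → (∀ s ∈ Y.faces, s.card ≤ n + 1) →
      Z.faces ⊆ Y.faces → Y.IsSimplicial K ψ →
      ∃ Y' ψ', Mv K Z A Y ψ Y' ψ' ∧ (∀ w ∈ A, ψ' w = ψ w) ∧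
        ∀ s ∈ Y'.faces, ∀ w ∈ s, ∀ w' ∈ s, ψ' w = ψ' w' → w = w' ∨ {w, w'} ∈ Z.faces := by
  induction n using Nat.strong_induction_on with
  | _ n IH =>
    intro K hK Y Z ψ A hfin hYA hdim hZY hψ
    obtain ⟨k, hk⟩ : ∃ k, (badSet Y Z ψ).ncard = k := ⟨_, rfl⟩
    induction k using Nat.strong_induction_on generalizing Y ψ A with
    | _ k ih =>
      rcases (badSet Y Z ψ).eq_empty_or_nonempty with hbad | hbad
      · refine ⟨Y, ψ, .refl, fun _ _ => rfl, fun s hs w hw w' hw' he => ?_⟩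
        by_contra hcon
        push Not at hcon
        have : ({w, w'} : Finset ℕ) ∈ badSet Y Z ψ := by
          refine ⟨Y.down_closed hs ?_ ⟨w, by simp⟩, hcon.2, ?_⟩
          · intro x hx
            simp only [Finset.mem_insert, Finset.mem_singleton] at hx
            rcases hx with rfl | rfl <;> assumption
          · intro x hx
            simp only [Finset.mem_insert, Finset.mem_singleton] at hx
            rcases hx with rfl | rfl
            · exact ⟨w', by simp, hcon.1.symm, he.symm⟩
            · exact ⟨w, by simp, hcon.1, he⟩
        simp [hbad] at this
      · obtain ⟨Y₁, ψ₁, h1, h2, h3⟩ := exists_mv_badSet_ssubset hK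
          (fun s hs hsn => hfill _ _ (by omega) (hK.2 s hs)) IH hfin hYA hdim hZY hψ hbad
        have hfin₁ := h1.sub.finite hfin
        obtain ⟨B, hB⟩ : ∃ B : Finset ℕ, ∀ s ∈ Y₁.faces, s ⊆ B :=
          ⟨hfin₁.toFinset.biUnion id, fun s hs =>
            Finset.subset_biUnion_of_mem id (hfin₁.mem_toFinset.2 hs)⟩
        have hlt : (badSet Y₁ Z ψ₁).ncard < k := by
          rw [← hk]
          exact Set.ncard_lt_ncard h3 (hfin.subset fun _ h => h.1)
        obtain ⟨Y₂, ψ₂, h4, h5, h6⟩ := ih _ hlt Y₁ ψ₁ (A ∪ B) hfin₁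
          (fun s hs => (hB s hs).trans Finset.subset_union_right) (h1.sub.card_le hdim)
          (h1.sub.le hZY) (h1.simplicial hψ) rfl
        exact ⟨Y₂, ψ₂, h1.trans (h4.mono Finset.subset_union_left), fun w hw => by
          rw [h5 w (Finset.mem_union_left _ hw), h2 w hw], h6⟩

end ASC

namespace ASC

variable {V : Type} [DecidableEq V]

/-- The part of a stellar subdivision of `cone c L` at `insert c σ` below the cone on the
stellar subdivision of `L` at `σ`. -/
def collar (L : ASC ℕ) (σ : Finset ℕ) (a : ℕ) : ASC ℕ where
  faces := {t | t ∈ L.faces ∨ (a ∈ t ∧ σ.Nonempty ∧ t.erase a ∪ σ ∈ L.faces)}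
  nonempty_of_mem := by
    rintro t (h | h)
    · exact L.nonempty_of_mem h
    · exact ⟨a, h.1⟩
  down_closed := by
    rintro s t (h | ⟨h1, h2, h3⟩) hts hne
    · exact Or.inl (L.down_closed h hts hne)
    · by_cases ha : a ∈ t
      · exact Or.inr ⟨ha, h2, L.down_closed h3
          (Finset.union_subset_union_left (Finset.erase_subset_erase a hts))
          (h2.mono Finset.subset_union_right)⟩
      · refine Or.inl (L.down_closed h3 (fun x hx => Finset.mem_union_left _ ?_) hne)
        exact Finset.mem_erase.2 ⟨fun h => ha (h ▸ hx), hts hx⟩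

theorem stellar_cone {L : ASC ℕ} {σ : Finset ℕ} {a c : ℕ} (hσ : σ ∈ L.faces) (hac : a ≠ c)
    (hc : ∀ s ∈ L.faces, c ∉ s) (ha : ∀ s ∈ L.faces, a ∉ s) :
    stellar (cone c L) (insert c σ) a = glue (collar L σ a) {c} (cone c (stellar L σ a)) := by
  have hne := L.nonempty_of_mem hσ
  have hcσ := hc σ hσ
  have hglue : ∀ t, t ∈ (glue (collar L σ a) {c} (cone c (stellar L σ a))).faces ↔
      t ∈ (collar L σ a).faces ∨ t ∈ (cone c (stellar L σ a)).faces := by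
    intro t
    constructor
    · rintro ⟨h1, h2 | ⟨τ, s, h2, h3, rfl⟩⟩
      · exact Or.inl h2
      · rw [Finset.ssubset_singleton_iff] at h2
        subst h2
        rcases h3 with rfl | h3
        · simp at h1
        · right; simpa using h3
    · rintro (h | h)
      · exact ⟨ASC.nonempty_of_mem _ h, Or.inl h⟩
      · exact Sub.mem_glue (by simp) h
  apply ext_faces
  intro t
  rw [hglue]
  constructor
  · rintro (⟨h1, ⟨h2, h3⟩, h4⟩ | ⟨h1, h2, h3, h4⟩)
    · by_cases hct : c ∈ t
      · right
        refine ⟨h2, h3.imp id fun h3 => Or.inl ⟨fun h => h1 (Finset.mem_of_mem_erase h), h3, ?_⟩⟩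
        intro h
        apply h4
        exact Finset.insert_subset hct (h.trans (Finset.erase_subset _ _))
      · left
        rw [Finset.erase_eq_of_notMem hct] at h3
        rcases h3 with h3 | h3
        · simp [h3] at h2
        · exact Or.inl h3
    · have h5 : (t.erase a ∪ insert c σ).erase c = (t.erase a).erase c ∪ σ := by
        ext x
        have : x = c → x ∉ σ := fun h => h ▸ hcσ
        simp; tauto
      rw [h5] at h4
      have h6 : (t.erase a).erase c ∪ σ ∈ L.faces := by
        rcases h4 with h4 | h4
        · simp [Finset.union_eq_empty] at h4
          simp [h4.2] at hne
        · exact h4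
      by_cases hct : c ∈ t
      · right
        refine ⟨⟨a, h1⟩, Or.inr (Or.inr ⟨by simp [hac, h1], fun h => h2 ?_, ?_⟩)⟩
        · refine Finset.insert_subset (by simp [hct, hac.symm]) (h.trans ?_)
          exact Finset.erase_subset_erase _ (Finset.erase_subset _ _)
        · rwa [Finset.erase_right_comm]
      · left
        refine Or.inr ⟨h1, hne, ?_⟩
        rwa [Finset.erase_eq_of_notMem (s := t.erase a) (by simp [hct])] at h6
  · have hL : ∀ t ∈ L.faces, t ∈ (stellar (cone c L) (insert c σ) a).faces := by
      intro t h
      refine Or.inl ⟨ha t h, ⟨L.nonempty_of_mem h, Or.inr ?_⟩, fun h' => hc t h (h' (by simp))⟩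
      rwa [Finset.erase_eq_of_notMem (hc t h)]
    have hcol : ∀ t, a ∈ t → t.erase a ∪ σ ∈ L.faces →
        t ∈ (stellar (cone c L) (insert c σ) a).faces := by
      intro t h1 h3
      have hct : c ∉ t.erase a := fun h => hc _ h3 (Finset.mem_union_left _ h)
      refine Or.inr ⟨h1, fun h => hct (h (by simp)), ⟨c, by simp⟩, Or.inr ?_⟩
      have : (t.erase a ∪ insert c σ).erase c = t.erase a ∪ σ := by
        ext x
        have : x = c → x ∉ t.erase a ∪ σ := fun h => h ▸ hc _ h3
        simp at this ⊢
        tauto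
      rwa [this]
    rintro ((h | ⟨h1, h2, h3⟩) | ⟨h1, h2⟩)
    · exact hL t h
    · exact hcol t h1 h3
    · by_cases hct : c ∈ t
      · rcases h2 with h2 | ⟨h2, h3, h4⟩ | ⟨h2, h3, h4⟩
        · rw [Finset.erase_eq_empty_iff] at h2
          have h2 : t = {c} := h2.resolve_left (by rintro rfl; simp at h1)
          subst h2
          refine Or.inl ⟨by simpa using hac, ⟨h1, by simp⟩, fun h => ?_⟩
          obtain ⟨x, hx⟩ := hne
          have := h (Finset.mem_insert_of_mem hx)
          rw [Finset.mem_singleton] at this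
          exact hcσ (this ▸ hx)
        · refine Or.inl ⟨fun h => h2 (by simp [hac, h]), ⟨h1, Or.inr h3⟩, fun h => h4 ?_⟩
          intro x hx
          exact Finset.mem_erase.2 ⟨fun h => hcσ (h ▸ hx), h (Finset.mem_insert_of_mem hx)⟩
        · refine Or.inr ⟨Finset.mem_of_mem_erase h2, fun h => h3 ?_, ⟨c, by simp⟩, Or.inr ?_⟩
          · intro x hx
            have h5 := h (Finset.mem_insert_of_mem hx)
            have h6 : x ≠ c := fun h => hcσ (h ▸ hx)
            simp at h5 ⊢
            tauto
          · have : (t.erase a ∪ insert c σ).erase c = (t.erase c).erase a ∪ σ := by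
              ext x
              have : x = c → x ∉ σ := fun h => h ▸ hcσ
              simp; tauto
            rwa [this]
      · rw [Finset.erase_eq_of_notMem hct] at h2
        rcases h2 with h2 | ⟨h2, h3, h4⟩ | ⟨h2, h3, h4⟩
        · simp [h2] at h1
        · exact hL t h3
        · exact hcol t h2 h4

theorem Fillable.of_stellar {K : ASC V} {A : Finset ℕ} {c : ℕ} {L : ASC ℕ} {ψ ψ' : ℕ → V}
    {σ : Finset ℕ} {a : ℕ} (hcA : c ∉ A) (hLA : ∀ s ∈ L.faces, s ⊆ A) (hψ : L.IsSimplicial K ψ)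
    (hσ : σ ∈ L.faces) (haA : a ∉ A) (hac : a ≠ c) (hψ' : ∀ w ∈ A, ψ' w = ψ w)
    (hleg : ∀ t ∈ L.faces, σ ⊆ t → insert (ψ' a) (t.image ψ) ∈ K.faces)
    (h : Fillable K (insert a A) c (stellar L σ a) ψ') : Fillable K A c L ψ := by
  obtain ⟨C, χ, h1, h2, h3⟩ := h
  have hc : ∀ s ∈ L.faces, c ∉ s := fun s hs h => hcA (hLA s hs h)
  have ha : ∀ s ∈ L.faces, a ∉ s := fun s hs h => haA (hLA s hs h)
  have hne := L.nonempty_of_mem hσ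
  have s1 : Sub L.faces A (cone c L) (stellar (cone c L) (insert c σ) a) := by
    refine .step .refl ⟨⟨c, by simp⟩, Or.inr ?_⟩ (fun h => hc _ h (by simp)) haA ?_
    · rwa [Finset.erase_insert (hc σ hσ)]
    · rintro ⟨-, h⟩
      rw [Finset.erase_eq_of_notMem (by simpa using hac.symm)] at h
      rcases h with h | h
      · simp at h
      · exact ha _ h (by simp)
  rw [stellar_cone hσ hac hc ha] at s1
  have hcolA : ∀ s ∈ (collar L σ a).faces, s ⊆ insert a A := by
    rintro s (h | ⟨h4, h5, h6⟩)
    · exact (hLA s h).trans (Finset.subset_insert _ _)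
    · rw [← Finset.erase_subset_iff_of_mem (Finset.mem_insert_self _ _)]
      exact Finset.subset_union_left.trans ((hLA _ h6).trans (Finset.subset_insert _ _))
  have hτ : ∀ τ : Finset ℕ, τ ⊂ {c} → τ = ∅ := fun τ hτ => Finset.ssubset_singleton_iff.1 hτ
  have s2 : Sub L.faces (insert a A) (glue (collar L σ a) {c} (cone c (stellar L σ a)))
      (glue (collar L σ a) {c} C) := by
    refine h1.glue_glue (by simp) ?_ ?_ hcolA ?_ ?_
    · rintro s ⟨h4, h5⟩ h6
      have hcs : c ∉ s := fun h => by
        rcases Finset.mem_insert.1 (hcolA s h6 h) with h | h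
        · exact hac h.symm
        · exact hcA h
      rw [Finset.erase_eq_of_notMem hcs] at h5
      rcases h5 with h5 | h5
      · simp [h5] at h4
      · exact h5
    · intro τ h s _; simp [hτ τ h]
    · intro τ h; simp [hτ τ h]
    · exact fun s hs => Or.inl hs
  refine ⟨_, χ, s1.trans (s2.mono (Finset.subset_insert _ _)), ?_, fun w hw => by
    rw [h3 w (Finset.mem_insert_of_mem hw), hψ' w hw]⟩
  have hχψ : ∀ w ∈ A, χ w = ψ w := fun w hw => by
    rw [h3 w (Finset.mem_insert_of_mem hw), hψ' w hw]
  have himg : ∀ t ⊆ A, t.image χ = t.image ψ := fun t ht =>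
    Finset.image_congr fun w hw => hχψ w (ht hw)
  rintro t ⟨h4, (h5 | ⟨h5, h6, h7⟩) | ⟨τ, s, h5, h6, rfl⟩⟩
  · rw [himg t (hLA t h5)]; exact hψ t h5
  · refine K.down_closed (hleg _ h7 Finset.subset_union_right) ?_ (h4.image _)
    intro x hx
    obtain ⟨w, hw, rfl⟩ := Finset.mem_image.1 hx
    by_cases hwa : w = a
    · rw [hwa, h3 a (by simp)]; simp
    · have hw' : w ∈ t.erase a ∪ σ := by simp [hwa, hw]
      rw [hχψ w (hLA _ h7 hw')]
      exact Finset.mem_insert_of_mem (Finset.mem_image_of_mem _ hw')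
  · rw [hτ τ h5, Finset.empty_union] at h4 ⊢
    rcases h6 with rfl | h6
    · simp at h4
    · exact h2 s h6

theorem Fillable.of_subset_face {K : ASC V} {A : Finset ℕ} {c : ℕ} {L : ASC ℕ} {ψ : ℕ → V}
    {e : Finset V} (hcA : c ∉ A) (he : e ∈ K.faces)
    (h : ∀ s ∈ L.faces, ∀ w ∈ s, ψ w ∈ e) : Fillable K A c L ψ := by
  obtain ⟨v, hv⟩ := K.nonempty_of_mem he
  refine ⟨_, Function.update ψ c v, .refl, ?_, fun w hw =>
    Function.update_of_ne (by rintro rfl; exact hcA hw) _ _⟩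
  rintro t ⟨h1, h2⟩
  refine K.down_closed he ?_ (h1.image _)
  intro x hx
  obtain ⟨w, hw, rfl⟩ := Finset.mem_image.1 hx
  by_cases hwc : w = c
  · simpa [hwc] using hv
  · rw [Function.update_of_ne hwc]
    have hw' : w ∈ t.erase c := by simp [hwc, hw]
    rcases h2 with h2 | h2
    · simp [h2] at hw'
    · exact h _ h2 w hw'

/-- Complexes whose vertices are placed in `E` so that all simplices satisfy `G`, and labelled so
that position and label of each vertex satisfy `p`. -/
structure Placed {E : Type} (G : Set E → Prop) (p : E → V → Prop) (A : Finset ℕ) (c : ℕ)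
    (L : ASC ℕ) (ψ : ℕ → V) (pos : ℕ → E) : Prop where
  notMem : c ∉ A
  subset : ∀ s ∈ L.faces, s ⊆ A
  good : ∀ s ∈ L.faces, G (pos '' s)
  label : ∀ s ∈ L.faces, ∀ w ∈ s, p (pos w) (ψ w)

/-- All labelled complexes placed according to `G` and `p` are fillable. -/
def FillAll {E : Type} (K : ASC V) (c : ℕ) (G : Set E → Prop) (p : E → V → Prop) : Prop :=
  ∀ A L ψ pos, Placed G p A c L ψ pos → Fillable K A c L ψ

theorem FillAll.of_relabel {E : Type} {K : ASC V} {c : ℕ} {G : Set E → Prop} {p q : E → V → Prop}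
    (hG : ∀ S S', S' ⊆ S → G S → G S')
    (hpq : ∀ S : Finset (E × V), S.Nonempty → G (Prod.fst '' (S : Set (E × V))) →
      (∀ z ∈ S, p z.1 z.2 ∨ q z.1 z.2) → S.image Prod.snd ∈ K.faces)
    (hq : ∀ y, G {y} → ∃ x, q y x) (h : FillAll K c G q) :
    FillAll K c G fun y x => p y x ∨ q y x := by
  classical
  intro A L ψ pos hP
  obtain ⟨k, hk⟩ : ∃ k, (A.filter fun w => {w} ∈ L.faces ∧ ¬ q (pos w) (ψ w)).card = k := ⟨_, rfl⟩
  induction k using Nat.strong_induction_on generalizing A L ψ pos with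
  | _ k ih =>
    by_cases hall : ∀ s ∈ L.faces, ∀ w ∈ s, q (pos w) (ψ w)
    · exact h A L ψ pos ⟨hP.notMem, hP.subset, hP.good, hall⟩
    push Not at hall
    obtain ⟨s, hs, w, hw, hwq⟩ := hall
    have hwL : {w} ∈ L.faces := L.down_closed hs (by simpa using hw) (by simp)
    have hwA := hP.subset _ hwL (Finset.mem_singleton_self w)
    obtain ⟨x, hx⟩ := hq (pos w) (hG _ _ (by simpa using ⟨w, hw, rfl⟩) (hP.good s hs))
    obtain ⟨a, ha⟩ := Infinite.exists_notMem_finset (insert c A)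
    rw [Finset.mem_insert, not_or] at ha
    obtain ⟨hac, haA⟩ := ha
    have hne : ∀ y ∈ A, y ≠ a := fun y hy h => haA (h ▸ hy)
    have hsimp : ∀ t ∈ L.faces, ∀ S' : Finset (E × V), S' ⊆ {(pos w, x)} → (S' ≠ ∅ → w ∈ t) →
        t.image ψ ∪ S'.image Prod.snd ∈ K.faces := by
      intro t ht S' hS' hwt
      have := hpq (t.image (fun y => (pos y, ψ y)) ∪ S')
        (((L.nonempty_of_mem ht).image _).mono Finset.subset_union_left) ?_ ?_
      · rw [Finset.image_union, Finset.image_image] at this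
        exact this
      · refine hG _ _ ?_ (hP.good t ht)
        rintro _ ⟨z, hz, rfl⟩
        rcases Finset.mem_union.1 (Finset.mem_coe.1 hz) with hz | hz
        · obtain ⟨y, hy, rfl⟩ := Finset.mem_image.1 hz
          exact ⟨y, hy, rfl⟩
        · have := hwt (Finset.ne_empty_of_mem hz)
          have hz' := Finset.mem_singleton.1 (hS' hz)
          exact ⟨w, this, by rw [hz']⟩
      · intro z hz
        rcases Finset.mem_union.1 hz with hz | hz
        · obtain ⟨y, hy, rfl⟩ := Finset.mem_image.1 hz
          exact hP.label t ht y hy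
        · rw [Finset.mem_singleton.1 (hS' hz)]
          exact Or.inr hx
    refine Fillable.of_stellar (σ := {w}) (a := a) (ψ' := Function.update ψ a x) hP.notMem
      hP.subset ?_ hwL haA hac (fun y hy => Function.update_of_ne (hne y hy) _ _) ?_ ?_
    · intro t ht
      simpa using hsimp t ht ∅ (by simp) (by simp)
    · intro t ht hwt
      have := hsimp t ht {(pos w, x)} subset_rfl (fun _ => hwt (by simp))
      rw [Finset.union_comm] at this
      rw [Function.update_self, Finset.insert_eq]
      exact this
    · have hpos : ∀ t : Finset ℕ, a ∉ t →
          Function.update pos a (pos w) '' t = pos '' (t : Set ℕ) := by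
        intro t hat
        refine Set.image_congr fun y hy => Function.update_of_ne ?_ _ _
        rintro rfl
        exact hat hy
      refine ih _ ?_ (insert a A) (stellar L {w} a) _ (Function.update pos a (pos w)) ?_ rfl
      · rw [← hk]
        apply Finset.card_lt_card
        rw [Finset.ssubset_iff_of_subset]
        · refine ⟨w, by simp [hwA, hwL, hwq], ?_⟩
          rw [Finset.mem_filter]
          rintro ⟨-, ⟨-, -, h⟩ | ⟨h, -⟩, -⟩
          · exact h subset_rfl
          · exact haA (Finset.mem_singleton.1 h ▸ hwA)
        · intro y hy
          rw [Finset.mem_filter] at hy ⊢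
          obtain ⟨h1, h2, h3⟩ := hy
          by_cases hya : y = a
          · subst hya; simp [hx] at h3
          · rw [Function.update_of_ne hya, Function.update_of_ne hya] at h3
            refine ⟨(Finset.mem_insert.1 h1).resolve_left hya, ?_, h3⟩
            rcases h2 with h2 | h2
            · exact h2.2.1
            · exact (hya (Finset.mem_singleton.1 h2.1).symm).elim
      · refine ⟨by simp [Ne.symm hac, hP.notMem], ?_, ?_, ?_⟩
        · rintro t (⟨h1, h2, h3⟩ | ⟨h1, h2, h3⟩)
          · exact (hP.subset t h2).trans (Finset.subset_insert _ _)
          · rw [← Finset.erase_subset_iff_of_mem (Finset.mem_insert_self _ _)]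
            exact Finset.subset_union_left.trans ((hP.subset _ h3).trans (Finset.subset_insert _ _))
        · rintro t (⟨h1, h2, h3⟩ | ⟨h1, h2, h3⟩)
          · rw [hpos t h1]; exact hP.good t h2
          · refine hG _ _ ?_ (hP.good _ h3)
            rintro _ ⟨y, hy, rfl⟩
            by_cases hya : y = a
            · exact ⟨w, by simp, by simp [hya]⟩
            · exact ⟨y, by simpa [hya] using Or.inr hy, by simp [hya]⟩
        · rintro t (⟨h1, h2, h3⟩ | ⟨h1, h2, h3⟩) y hy
          · have hya : y ≠ a := fun h => h1 (h ▸ hy)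
            rw [Function.update_of_ne hya, Function.update_of_ne hya]
            exact hP.label t h2 y hy
          · by_cases hya : y = a
            · subst hya; simp [hx]
            · rw [Function.update_of_ne hya, Function.update_of_ne hya]
              exact hP.label _ h3 y (by simp [hya, hy])

end ASC

namespace ASC

variable {V U : Type} [DecidableEq V]

/-- The closed simplex with vertex set `s`, in barycentric coordinates. -/
def simplexSet (s : Finset U) : Set (U → ℝ) :=
  {x | (∀ v, 0 ≤ x v) ∧ (∀ v, v ∉ s → x v = 0) ∧ ∑ v ∈ s, x v = 1}

theorem mem_space_iff {K : ASC U} {x : U → ℝ} : x ∈ K.space ↔ ∃ s ∈ K.faces, x ∈ simplexSet s :=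
  ⟨fun ⟨h, s, hs, h'⟩ => ⟨s, hs, h, h'⟩, fun ⟨s, hs, h, h'⟩ => ⟨h, s, hs, h'⟩⟩

theorem convex_simplexSet (s : Finset U) : Convex ℝ (simplexSet s) := by
  rintro x ⟨h1, h2, h3⟩ y ⟨h4, h5, h6⟩ a b ha hb hab
  refine ⟨fun v => ?_, fun v hv => by simp [h2 v hv, h5 v hv], ?_⟩
  · exact add_nonneg (mul_nonneg ha (h1 v)) (mul_nonneg hb (h4 v))
  · simp only [Pi.add_apply, Pi.smul_apply, smul_eq_mul, Finset.sum_add_distrib,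
      ← Finset.mul_sum, h3, h6, mul_one, hab]

theorem le_one_of_mem_simplexSet {s : Finset U} {x : U → ℝ} (h : x ∈ simplexSet s) (v : U) :
    x v ≤ 1 := by
  by_cases hv : v ∈ s
  · rw [← h.2.2]
    exact Finset.single_le_sum (f := x) (fun i _ => h.1 i) hv
  · rw [h.2.1 v hv]; exact zero_le_one

theorem mem_faces_of_pos {K : ASC U} {x : U → ℝ} (hx : x ∈ K.space) {t : Finset U}
    (ht : t.Nonempty) (h : ∀ v ∈ t, 0 < x v) : t ∈ K.faces := by
  obtain ⟨-, s, hs, h1, -⟩ := hx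
  refine K.down_closed hs (fun v hv => ?_) ht
  by_contra hvs
  exact (h v hv).ne' (h1 v hvs)

theorem exists_pos_of_mem_space {K : ASC U} {x : U → ℝ} (hx : x ∈ K.space) : ∃ v, 0 < x v := by
  obtain ⟨h0, s, hs, h1, h2⟩ := hx
  by_contra h
  push Not at h
  have : ∑ v ∈ s, x v = 0 := Finset.sum_eq_zero fun v _ => le_antisymm (h v) (h0 v)
  linarith

theorem push_pos [Fintype U] {φ : U → V} {x : U → ℝ} (h0 : ∀ u, 0 ≤ x u) {u : U} (hu : 0 < x u) :
    0 < push φ x (φ u) := by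
  rw [push, finsum_mem_eq_finite_toFinset_sum _ (Set.toFinite _)]
  exact Finset.sum_pos' (fun i _ => h0 i) ⟨u, by simp, hu⟩

/-- The points of `S` lie in a common face. -/
def InFace (L : ASC U) (S : Set (U → ℝ)) : Prop := ∃ s ∈ L.faces, S ⊆ simplexSet s

/-- The points of `S` lie in a common face, at mutual distance less than `δ`. -/
def Mesh [Fintype U] (L : ASC U) (δ : ℝ) (S : Set (U → ℝ)) : Prop :=
  InFace L S ∧ ∀ y ∈ S, ∀ z ∈ S, dist y z < δ

theorem InFace.mono {L : ASC U} {S S' : Set (U → ℝ)} (h : InFace L S) (hS : S' ⊆ S) :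
    InFace L S' := by
  obtain ⟨s, hs, h⟩ := h
  exact ⟨s, hs, hS.trans h⟩

theorem Mesh.mono [Fintype U] {L : ASC U} {δ : ℝ} {S S' : Set (U → ℝ)} (h : Mesh L δ S)
    (hS : S' ⊆ S) : Mesh L δ S' :=
  ⟨h.1.mono hS, fun y hy z hz => h.2 y (hS hy) z (hS hz)⟩

theorem InFace.mem_space {L : ASC U} {S : Set (U → ℝ)} (h : InFace L S) {y : U → ℝ}
    (hy : y ∈ S) : y ∈ L.space := by
  obtain ⟨s, hs, h⟩ := h
  exact mem_space_iff.2 ⟨s, hs, h hy⟩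

theorem FillAll.mono {E : Type} {K : ASC V} {c : ℕ} {G : Set E → Prop} {p p' : E → V → Prop}
    (h : FillAll K c G p') (hp : ∀ y x, p y x → p' y x) : FillAll K c G p :=
  fun A L ψ pos hP => h A L ψ pos
    ⟨hP.notMem, hP.subset, hP.good, fun s hs w hw => hp _ _ (hP.label s hs w hw)⟩

/-- The squared Euclidean distance. -/
noncomputable def sqDist [Fintype U] (y z : U → ℝ) : ℝ := ∑ i, (y i - z i) ^ 2

theorem sqDist_comm [Fintype U] (y z : U → ℝ) : sqDist y z = sqDist z y :=
  Finset.sum_congr rfl fun i _ => by ring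

theorem sqDist_self [Fintype U] (y : U → ℝ) : sqDist y y = 0 := by simp [sqDist]

theorem sqDist_half [Fintype U] (v w y : U → ℝ) :
    sqDist (fun i => (v i + w i) / 2) y = sqDist v y / 2 + sqDist w y / 2 - sqDist v w / 4 := by
  simp only [sqDist, Finset.sum_div, ← Finset.sum_add_distrib, ← Finset.sum_sub_distrib]
  exact Finset.sum_congr rfl fun i _ => by ring

theorem dist_lt_of_sqDist_lt [Fintype U] {y z : U → ℝ} {δ : ℝ} (hδ : 0 < δ)
    (h : sqDist y z < δ ^ 2) : dist y z < δ := by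
  rw [dist_pi_lt_iff hδ]
  intro i
  rw [Real.dist_eq]
  apply abs_lt_of_sq_lt_sq _ hδ.le
  refine lt_of_le_of_lt ?_ h
  exact Finset.single_le_sum (f := fun i => (y i - z i) ^ 2) (fun i _ => sq_nonneg _)
    (Finset.mem_univ i)

theorem half_mem_simplexSet {s : Finset U} {y z : U → ℝ} (hy : y ∈ simplexSet s)
    (hz : z ∈ simplexSet s) : (fun i => (y i + z i) / 2) ∈ simplexSet s := by
  convert convex_simplexSet s hy hz (a := 1 / 2) (b := 1 / 2) (by norm_num) (by norm_num)
    (by norm_num) using 1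
  ext i
  simp; ring

/-- Complexes placed in the faces of `L₀`, with edges of squared length at most `D`, are
fillable. -/
def FillShort [Fintype U] (K : ASC V) (c : ℕ) (L₀ : ASC U) (p : (U → ℝ) → V → Prop) (D : ℝ) :
    Prop :=
  ∀ A L ψ pos, Placed (InFace L₀) p A c L ψ pos →
    (∀ v w, {v, w} ∈ L.faces → sqDist (pos v) (pos w) ≤ D) → Fillable K A c L ψ

theorem FillShort.bisect [Fintype U] {K : ASC V} {c : ℕ} {L₀ : ASC U} {p : (U → ℝ) → V → Prop}
    {D : ℝ} (hD : 0 ≤ D)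
    (hp : ∀ S : Finset ((U → ℝ) × V), S.Nonempty → InFace L₀ (Prod.fst '' (S : Set ((U → ℝ) × V))) →
      (∀ z ∈ S, p z.1 z.2) → S.image Prod.snd ∈ K.faces)
    (hhalf : ∀ y z x, p y x → InFace L₀ {y, z} → p (fun i => (y i + z i) / 2) x)
    (h : FillShort K c L₀ p D) : FillShort K c L₀ p (4 / 3 * D) := by
  classical
  intro A L ψ pos hP hlen
  obtain ⟨k, hk⟩ : ∃ k, ((A ×ˢ A).filter fun e => {e.1, e.2} ∈ L.faces ∧
    D < sqDist (pos e.1) (pos e.2)).card = k := ⟨_, rfl⟩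
  induction k using Nat.strong_induction_on generalizing A L ψ pos with
  | _ k ih =>
    by_cases hall : ∀ v w, {v, w} ∈ L.faces → sqDist (pos v) (pos w) ≤ D
    · exact h A L ψ pos hP hall
    obtain ⟨⟨v, w⟩, hvw, hmax⟩ := ((A ×ˢ A).filter fun e => {e.1, e.2} ∈ L.faces ∧
        D < sqDist (pos e.1) (pos e.2)).exists_max_image
        (fun e => sqDist (pos e.1) (pos e.2)) (by
      push Not at hall
      obtain ⟨v, w, h1, h2⟩ := hall
      have := hP.subset _ h1
      exact ⟨(v, w), by simp [this (show v ∈ _ by simp), this (show w ∈ _ by simp), h1, h2]⟩)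
    simp only [Finset.mem_filter, Finset.mem_product] at hvw hmax
    obtain ⟨⟨hvA, hwA⟩, hvwL, hDvw⟩ := hvw
    have hmax' : ∀ x y, {x, y} ∈ L.faces → sqDist (pos x) (pos y) ≤ sqDist (pos v) (pos w) := by
      intro x y hxy
      by_cases h1 : D < sqDist (pos x) (pos y)
      · have := hP.subset _ hxy
        exact hmax (x, y) ⟨⟨this (by simp), this (by simp)⟩, hxy, h1⟩
      · linarith
    obtain ⟨a, ha⟩ := Infinite.exists_notMem_finset (insert c A)
    rw [Finset.mem_insert, not_or] at ha
    obtain ⟨hac, haA⟩ := ha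
    set m : U → ℝ := fun i => (pos v i + pos w i) / 2 with hm
    have hne : ∀ y ∈ A, y ≠ a := fun y hy h => haA (h ▸ hy)
    have hLa : ∀ t ∈ L.faces, a ∉ t := fun t ht h => haA (hP.subset t ht h)
    have hInvw : InFace L₀ {pos v, pos w} := (hP.good _ hvwL).mono (by simp [Set.image_pair])
    have hpm : p m (ψ v) := hhalf _ _ _ (hP.label _ hvwL v (by simp)) hInvw
    have hstar : ∀ t ∈ L.faces, {v, w} ⊆ t → InFace L₀ (insert m (pos '' t)) := by
      intro t ht hvwt
      obtain ⟨s, hs, h1⟩ := hP.good t ht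
      refine ⟨s, hs, Set.insert_subset ?_ h1⟩
      exact half_mem_simplexSet (h1 ⟨v, hvwt (by simp), rfl⟩) (h1 ⟨w, hvwt (by simp), rfl⟩)
    have hshort : ∀ y, {y} ∪ {v, w} ∈ L.faces → sqDist m (pos y) ≤ D := by
      intro y hy
      rw [hm, sqDist_half]
      have h1 := hmax' v y (L.down_closed hy (by intro x; simp; tauto) (by simp))
      have h2 := hmax' w y (L.down_closed hy (by intro x; simp; tauto) (by simp))
      have h3 := hlen v w hvwL
      linarith
    have hlen' : ∀ x y, {x, y} ∈ (stellar L {v, w} a).faces →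
        sqDist (Function.update pos a m x) (Function.update pos a m y) ≤ D ∨
        {x, y} ∈ L.faces ∧ x ≠ a ∧ y ≠ a ∧ ¬ {v, w} ⊆ ({x, y} : Finset ℕ) := by
      rintro x y (⟨h1, h2, h3⟩ | ⟨h1, h2, h3⟩)
      · right
        simp only [Finset.mem_insert, Finset.mem_singleton, not_or] at h1
        exact ⟨h2, Ne.symm h1.1, Ne.symm h1.2, h3⟩
      · left
        by_cases hx : x = a <;> by_cases hy : y = a
        · rw [hx, hy, sqDist_self]; exact hD
        · rw [hx, Function.update_self, Function.update_of_ne hy]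
          refine hshort y (L.down_closed h3 (Finset.union_subset_union_left ?_) (by simp))
          simp [hy]
        · rw [hy, Function.update_self, Function.update_of_ne hx, sqDist_comm]
          refine hshort x (L.down_closed h3 (Finset.union_subset_union_left ?_) (by simp))
          simp [hx]
        · simp [Ne.symm hx, Ne.symm hy] at h1
    refine Fillable.of_stellar (σ := {v, w}) (a := a) (ψ' := Function.update ψ a (ψ v)) hP.notMem
      hP.subset ?_ hvwL haA hac (fun y hy => Function.update_of_ne (hne y hy) _ _) ?_ ?_
    · intro t ht
      have := hp (t.image fun y => (pos y, ψ y)) ((L.nonempty_of_mem ht).image _) ?_ ?_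
      · rwa [Finset.image_image] at this
      · refine (hP.good t ht).mono ?_
        rintro _ ⟨_, hz, rfl⟩
        obtain ⟨y, hy, rfl⟩ := Finset.mem_image.1 hz
        exact ⟨y, hy, rfl⟩
      · intro z hz
        obtain ⟨y, hy, rfl⟩ := Finset.mem_image.1 hz
        exact hP.label t ht y hy
    · intro t ht hvt
      rw [Function.update_self]
      have := hp (insert (m, ψ v) (t.image fun y => (pos y, ψ y))) (by simp) ?_ ?_
      · rwa [Finset.image_insert, Finset.image_image] at this
      · refine (hstar t ht hvt).mono ?_
        rintro _ ⟨z, hz, rfl⟩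
        rcases Finset.mem_insert.1 (Finset.mem_coe.1 hz) with rfl | hz
        · exact Or.inl rfl
        · obtain ⟨y, hy, rfl⟩ := Finset.mem_image.1 hz
          exact Or.inr ⟨y, hy, rfl⟩
      · intro z hz
        rcases Finset.mem_insert.1 hz with rfl | hz
        · exact hpm
        · obtain ⟨y, hy, rfl⟩ := Finset.mem_image.1 hz
          exact hP.label t ht y hy
    · refine ih _ ?_ (insert a A) (stellar L {v, w} a) _ (Function.update pos a m) ?_ ?_ rfl
      · rw [← hk]
        apply Finset.card_lt_card
        rw [Finset.ssubset_iff_of_subset]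
        · refine ⟨(v, w), by simp [hvA, hwA, hvwL, hDvw], ?_⟩
          rw [Finset.mem_filter]
          rintro ⟨-, h1, h2⟩
          rcases hlen' _ _ h1 with h3 | h3
          · exact absurd h2 (not_lt.2 h3)
          · exact h3.2.2.2 subset_rfl
        · rintro ⟨x, y⟩ hxy
          simp only [Finset.mem_filter, Finset.mem_product] at hxy ⊢
          obtain ⟨h1, h2, h3⟩ := hxy
          rcases hlen' _ _ h2 with h4 | ⟨h4, h5, h6, -⟩
          · exact absurd h3 (not_lt.2 h4)
          · have := hP.subset _ h4
            rw [Function.update_of_ne h5, Function.update_of_ne h6] at h3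
            exact ⟨⟨this (by simp), this (by simp)⟩, h4, h3⟩
      · refine ⟨by simp [Ne.symm hac, hP.notMem], ?_, ?_, ?_⟩
        · rintro t (⟨h1, h2, h3⟩ | ⟨h1, h2, h3⟩)
          · exact (hP.subset t h2).trans (Finset.subset_insert _ _)
          · rw [← Finset.erase_subset_iff_of_mem (Finset.mem_insert_self _ _)]
            exact Finset.subset_union_left.trans ((hP.subset _ h3).trans (Finset.subset_insert _ _))
        · rintro t (⟨h1, h2, h3⟩ | ⟨h1, h2, h3⟩)
          · refine (hP.good t h2).mono ?_
            rintro _ ⟨y, hy, rfl⟩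
            rw [Function.update_of_ne (by rintro rfl; exact h1 hy)]
            exact ⟨y, hy, rfl⟩
          · refine (hstar _ h3 Finset.subset_union_right).mono ?_
            rintro _ ⟨y, hy, rfl⟩
            by_cases hya : y = a
            · rw [hya, Function.update_self]; exact Or.inl rfl
            · rw [Function.update_of_ne hya]
              refine Or.inr ⟨y, ?_, rfl⟩
              exact Finset.mem_coe.2 (Finset.mem_union_left _ (Finset.mem_erase.2 ⟨hya, hy⟩))
        · rintro t (⟨h1, h2, h3⟩ | ⟨h1, h2, h3⟩) y hy
          · have hya : y ≠ a := fun h => h1 (h ▸ hy)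
            rw [Function.update_of_ne hya, Function.update_of_ne hya]
            exact hP.label t h2 y hy
          · by_cases hya : y = a
            · rw [hya, Function.update_self, Function.update_self]; exact hpm
            · rw [Function.update_of_ne hya, Function.update_of_ne hya]
              exact hP.label _ h3 y (Finset.mem_union_left _ (Finset.mem_erase.2 ⟨hya, hy⟩))
      · intro x y hxy
        rcases hlen' x y hxy with h1 | ⟨h1, h2, h3, -⟩
        · linarith
        · rw [Function.update_of_ne h2, Function.update_of_ne h3]
          exact hlen x y h1

theorem FillAll.of_mesh [Fintype U] {K : ASC V} {c : ℕ} {L₀ : ASC U} {p : (U → ℝ) → V → Prop}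
    {δ : ℝ} (hδ : 0 < δ)
    (hp : ∀ S : Finset ((U → ℝ) × V), S.Nonempty → InFace L₀ (Prod.fst '' (S : Set ((U → ℝ) × V))) →
      (∀ z ∈ S, p z.1 z.2) → S.image Prod.snd ∈ K.faces)
    (hhalf : ∀ y z x, p y x → InFace L₀ {y, z} → p (fun i => (y i + z i) / 2) x)
    (h : FillAll K c (Mesh L₀ δ) p) : FillAll K c (InFace L₀) p := by
  have hD : 0 < δ ^ 2 / 2 := by positivity
  have h0 : FillShort K c L₀ p (δ ^ 2 / 2) := by
    intro A L ψ pos hP hlen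
    refine h A L ψ pos ⟨hP.notMem, hP.subset, fun s hs => ⟨hP.good s hs, ?_⟩, hP.label⟩
    rintro _ ⟨v, hv, rfl⟩ _ ⟨w, hw, rfl⟩
    apply dist_lt_of_sqDist_lt hδ
    have := hlen v w (L.down_closed hs (by intro x; simp; rintro (rfl | rfl) <;> assumption)
      (by simp))
    linarith
  have hk : ∀ k : ℕ, FillShort K c L₀ p ((4 / 3) ^ k * (δ ^ 2 / 2)) := by
    intro k
    induction k with
    | zero => simpa using h0
    | succ k ih =>
      rw [pow_succ', mul_assoc]
      exact ih.bisect (by positivity) hp hhalf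
  obtain ⟨k, hk'⟩ := pow_unbounded_of_one_lt (Fintype.card U / (δ ^ 2 / 2) : ℝ)
    (show (1 : ℝ) < 4 / 3 by norm_num)
  rw [div_lt_iff₀ hD] at hk'
  intro A L ψ pos hP
  refine hk k A L ψ pos hP fun v w hvw => le_trans ?_ hk'.le
  obtain ⟨s, hs, h1⟩ := hP.good _ hvw
  have h2 := h1 ⟨v, by simp, rfl⟩
  have h3 := h1 ⟨w, by simp, rfl⟩
  calc sqDist (pos v) (pos w) ≤ ∑ _i : U, (1 : ℝ) := by
        refine Finset.sum_le_sum fun i _ => ?_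
        have := h2.1 i
        have := h3.1 i
        have := le_one_of_mem_simplexSet h2 i
        have := le_one_of_mem_simplexSet h3 i
        rw [sq_le_one_iff_abs_le_one, abs_le]
        constructor <;> linarith
    _ = _ := by simp

theorem isCompact_simplexSet (s : Finset U) : IsCompact (simplexSet s) := by
  have hsub : simplexSet s ⊆ Set.Icc (0 : U → ℝ) 1 := fun x hx =>
    ⟨fun v => hx.1 v, fun v => le_one_of_mem_simplexSet hx v⟩
  refine isCompact_Icc.of_isClosed_subset ?_ hsub
  have : simplexSet s = (⋂ v, {x : U → ℝ | 0 ≤ x v}) ∩ (⋂ v, ⋂ (_ : v ∉ s), {x : U → ℝ | x v = 0}) ∩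
      {x | ∑ v ∈ s, x v = 1} := by
    ext x; simp [simplexSet, and_assoc]
  rw [this]
  refine ((isClosed_iInter fun v => ?_).inter
    (isClosed_iInter fun v => isClosed_iInter fun _ => ?_)).inter ?_
  · exact isClosed_le continuous_const (continuous_apply v)
  · exact isClosed_eq (continuous_apply v) continuous_const
  · exact isClosed_eq (continuous_finsetSum _ fun v _ => continuous_apply v) continuous_const

theorem isCompact_space [Fintype U] (L : ASC U) : IsCompact L.space := by
  have : L.space = ⋃ s ∈ L.faces, simplexSet s := by ext x; simp [mem_space_iff]
  rw [this]
  exact (Set.toFinite _).isCompact_biUnion fun s _ => isCompact_simplexSet s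

theorem fillAll_of_homotopy [Fintype U] [DecidableEq U] {K : ASC V} {L₀ : ASC U} {ψ₀ : U → V}
    (hψ₀ : L₀.IsSimplicial K ψ₀) (H : C(L₀.space × unitInterval, K.space)) (x₀ : K.space)
    (H0 : ∀ y, (H (y, 0) : V → ℝ) = push ψ₀ y) (H1 : ∀ y, H (y, 1) = x₀) (c : ℕ) :
    FillAll K c (InFace L₀) fun y x => ∃ i, ψ₀ i = x ∧ 0 < y i := by
  have : CompactSpace L₀.space := isCompact_iff_compactSpace.1 (isCompact_space L₀)
  obtain ⟨δ, hδ, hleb⟩ := lebesgue_number_lemma_of_metric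
    (s := (Set.univ : Set (L₀.space × unitInterval))) isCompact_univ
    (c := fun x : V => {z | 0 < (H z : V → ℝ) x})
    (fun x => isOpen_lt continuous_const
      ((continuous_apply x).comp (continuous_subtype_val.comp H.continuous)))
    (fun z _ => by
      obtain ⟨v, hv⟩ := exists_pos_of_mem_space (H z).2
      exact Set.mem_iUnion.2 ⟨v, hv⟩)
  obtain ⟨N, hN⟩ := exists_nat_gt (1 / δ)
  have hN0 : (0 : ℝ) < N := lt_trans (by positivity) hN
  have hNδ : 1 < N * δ := by rwa [div_lt_iff₀ hδ] at hN
  let q : ℕ → (U → ℝ) → V → Prop := fun j y₀ x => ∀ y : L₀.space, dist (y : U → ℝ) y₀ < δ →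
    ∀ t : unitInterval, (j : ℝ) ≤ N * (t : ℝ) → N * (t : ℝ) ≤ j + 1 → 0 < (H (y, t) : V → ℝ) x
  have hq : ∀ j, j < N → ∀ y, Mesh L₀ δ {y} → ∃ x, q j y x := by
    intro j hj y hy
    have hjN : (j : ℝ) / N ∈ unitInterval :=
      ⟨by positivity, by rw [div_le_one hN0]; exact_mod_cast hj.le⟩
    obtain ⟨x, hx⟩ := hleb (⟨y, hy.1.mem_space rfl⟩, ⟨j / N, hjN⟩) trivial
    refine ⟨x, fun y' hy' t h1 h2 => hx ?_⟩
    rw [Metric.mem_ball, Prod.dist_eq, max_lt_iff]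
    refine ⟨hy', ?_⟩
    rw [Subtype.dist_eq, Real.dist_eq, abs_lt]
    have h3 : (j : ℝ) / N * N = j := by field_simp
    have h4 : N * ((t : ℝ) - j / N) = N * t - j := by linarith
    change -δ < (t : ℝ) - j / N ∧ (t : ℝ) - j / N < δ
    constructor
    · refine lt_of_mul_lt_mul_left ?_ hN0.le
      linarith
    · refine lt_of_mul_lt_mul_left ?_ hN0.le
      linarith
  have hmem : ∀ {S : Set (U → ℝ)} {y}, Mesh L₀ δ S → y ∈ S → y ∈ L₀.space :=
    fun h hy => h.1.mem_space hy
  have hqs : ∀ k j, j + 1 + k = N → FillAll K c (Mesh L₀ δ) (q j) := by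
    intro k
    induction k with
    | zero =>
      intro j hj A L ψ pos hP
      have hjN : (j : ℝ) + 1 = N := by exact_mod_cast hj
      obtain ⟨e, he, hx₀⟩ := mem_space_iff.1 x₀.2
      refine Fillable.of_subset_face hP.notMem he fun s hs w hw => ?_
      have hw' : pos w ∈ L₀.space := hmem (hP.good s hs) ⟨w, hw, rfl⟩
      have := hP.label s hs w hw ⟨pos w, hw'⟩ (by simpa using hδ) 1 (by simp [← hjN])
        (by simp [← hjN])
      rw [H1] at this
      by_contra h
      exact this.ne' (hx₀.2.1 _ h)
    | succ k ih =>
      intro j hj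
      have hjN : (j : ℝ) + 1 ≤ N := by exact_mod_cast (by omega : j + 1 ≤ N)
      have htN : ((j : ℝ) + 1) / N ∈ unitInterval := ⟨by positivity, by rwa [div_le_one hN0]⟩
      have ht : (N : ℝ) * (((j : ℝ) + 1) / N) = j + 1 := by field_simp
      refine FillAll.mono (FillAll.of_relabel (q := q (j + 1)) (fun S S' h1 h2 => h2.mono h1) ?_
        (hq (j + 1) (by omega)) (ih (j + 1) (by omega))) fun y x h => Or.inl h
      rintro S ⟨z₀, hz₀⟩ hS hlab
      have hy := hmem hS ⟨z₀, hz₀, rfl⟩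
      refine mem_faces_of_pos (H (⟨z₀.1, hy⟩, ⟨((j : ℝ) + 1) / N, htN⟩)).2
        (Finset.Nonempty.image ⟨z₀, hz₀⟩ _) ?_
      intro x hx
      obtain ⟨z, hz, rfl⟩ := Finset.mem_image.1 hx
      have hd := hS.2 z₀.1 ⟨z₀, hz₀, rfl⟩ z.1 ⟨z, hz, rfl⟩
      rcases hlab z hz with h | h
      · exact h ⟨z₀.1, hy⟩ hd ⟨((j : ℝ) + 1) / N, htN⟩ (by rw [ht]; linarith) ht.le
      · exact h ⟨z₀.1, hy⟩ hd ⟨((j : ℝ) + 1) / N, htN⟩ (by rw [ht]; push_cast; rfl)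
          (by rw [ht]; push_cast; linarith)
  have hN1 : 0 < N := by exact_mod_cast hN0
  refine FillAll.of_mesh hδ ?_ ?_ ?_
  · rintro S hS ⟨s, hs, hSs⟩ hlab
    refine K.down_closed (hψ₀ s hs) ?_ (hS.image _)
    intro x hx
    obtain ⟨z, hz, rfl⟩ := Finset.mem_image.1 hx
    obtain ⟨i, hi, hi'⟩ := hlab z hz
    rw [← hi]
    refine Finset.mem_image_of_mem _ ?_
    by_contra his
    exact hi'.ne' ((hSs ⟨z, hz, rfl⟩).2.1 i his)
  · rintro y z x ⟨i, hi, hi'⟩ ⟨s, hs, h⟩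
    refine ⟨i, hi, ?_⟩
    have := (h (show z ∈ _ by simp)).1 i
    positivity
  · refine FillAll.mono (FillAll.of_relabel (q := q 0) (fun S S' h1 h2 => h2.mono h1) ?_
      (hq 0 hN1) (hqs (N - 1) 0 (by omega))) fun y x h => Or.inl h
    rintro S hS ⟨⟨s, hs, hSs⟩, hSd⟩ hlab
    have hcard : (0 : ℝ) < (S.card : ℝ) := by exact_mod_cast hS.card_pos
    have hsum : ∑ _z ∈ S, (1 : ℝ) / S.card = 1 := by
      rw [Finset.sum_const, nsmul_eq_mul]; field_simp
    set b : U → ℝ := ∑ z ∈ S, ((1 : ℝ) / S.card) • z.1 with hb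
    have hbs : b ∈ simplexSet s := (convex_simplexSet s).sum_mem (fun _ _ => by positivity) hsum
      fun z hz => hSs ⟨z, hz, rfl⟩
    have hbd : ∀ z ∈ S, dist b z.1 < δ := fun z hz =>
      (convex_ball z.1 δ).sum_mem (fun _ _ => by positivity) hsum
        fun z' hz' => hSd z'.1 ⟨z', hz', rfl⟩ z.1 ⟨z, hz, rfl⟩
    have hbL : b ∈ L₀.space := mem_space_iff.2 ⟨s, hs, hbs⟩
    refine mem_faces_of_pos (H (⟨b, hbL⟩, 0)).2 (hS.image _) ?_
    intro x hx
    obtain ⟨z, hz, rfl⟩ := Finset.mem_image.1 hx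
    rcases hlab z hz with ⟨i, hi, hi'⟩ | h
    · rw [H0, ← hi]
      refine push_pos hbs.1 (lt_of_lt_of_le (b := 1 / (S.card : ℝ) * z.1 i) (by positivity) ?_)
      simp only [hb, Finset.sum_apply, Pi.smul_apply, smul_eq_mul]
      refine Finset.single_le_sum (f := fun z : (U → ℝ) × V => 1 / (S.card : ℝ) * z.1 i)
        (fun z' hz' => ?_) hz
      have := (hSs ⟨z', hz', rfl⟩).1 i
      positivity
    · exact h ⟨b, hbL⟩ (hbd z hz) 0 (by simp) (by simp)

end ASC

section Nullhomotopies

open scoped unitInterval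

section CubeFilling

variable {N : Type}

/-- The affine identification of the cube with the unit ball of the sup norm. -/
def ballOfCube (z : N → I) : N → ℝ := fun i => 2 * z i - 1

/-- The inverse of `ballOfCube`, extended by projection to all of `N → ℝ`. -/
noncomputable def cubeOfBall (y : N → ℝ) : N → I :=
  fun i => Set.projIcc 0 1 zero_le_one ((y i + 1) / 2)

theorem continuous_ballOfCube : Continuous (ballOfCube (N := N)) := by
  unfold ballOfCube; fun_prop

theorem continuous_cubeOfBall : Continuous (cubeOfBall (N := N)) := by
  unfold cubeOfBall
  exact continuous_pi fun i => continuous_projIcc.comp (by fun_prop)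

theorem cubeOfBall_ballOfCube (z : N → I) : cubeOfBall (ballOfCube z) = z := by
  ext i
  have : (2 * (z i : ℝ) - 1 + 1) / 2 = z i := by ring
  simp [cubeOfBall, ballOfCube]

variable [Fintype N]

theorem norm_ballOfCube_le (z : N → I) : ‖ballOfCube z‖ ≤ 1 := by
  rw [pi_norm_le_iff_of_nonneg zero_le_one]
  intro i
  have := (z i).2.1
  have := (z i).2.2
  rw [Real.norm_eq_abs, abs_le, ballOfCube]
  constructor <;> linarith

theorem ballOfCube_cubeOfBall {y : N → ℝ} (hy : ‖y‖ ≤ 1) : ballOfCube (cubeOfBall y) = y := by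
  ext i
  have := (norm_le_pi_norm y i).trans hy
  rw [Real.norm_eq_abs, abs_le] at this
  rw [ballOfCube, cubeOfBall, Set.projIcc_of_mem _ ⟨by linarith, by linarith⟩]
  ring

theorem norm_ballOfCube_eq_one_iff {z : N → I} :
    ‖ballOfCube z‖ = 1 ↔ z ∈ Cube.boundary N := by
  constructor
  · intro h
    by_contra hz
    have : ‖ballOfCube z‖ < 1 := by
      rw [pi_norm_lt_iff zero_lt_one]
      intro i
      have h0 : 0 < (z i : ℝ) := unitInterval.pos_iff_ne_zero.2 fun h => hz ⟨i, Or.inl h⟩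
      have h1 : (z i : ℝ) < 1 := unitInterval.lt_one_iff_ne_one.2 fun h => hz ⟨i, Or.inr h⟩
      rw [Real.norm_eq_abs, abs_lt, ballOfCube]
      constructor <;> linarith
    exact this.ne h
  · rintro ⟨i, hi⟩
    refine le_antisymm (norm_ballOfCube_le z) ?_
    refine le_trans ?_ (norm_le_pi_norm _ i)
    rcases hi with hi | hi <;> norm_num [ballOfCube, hi]

theorem cubeOfBall_mem_boundary {y : N → ℝ} (hy : ‖y‖ = 1) : cubeOfBall y ∈ Cube.boundary N := by
  rw [← norm_ballOfCube_eq_one_iff, ballOfCube_cubeOfBall hy.le, hy]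

theorem norm_inv_norm_smul {y : N → ℝ} (hy : 0 < ‖y‖) : ‖(‖y‖⁻¹ • y)‖ = 1 := by
  rw [norm_smul, norm_inv, norm_norm, inv_mul_cancel₀ hy.ne']

/-- Shrinking `f` to the inner half of the cube and using `b` as a collar. -/
theorem exists_continuous_collar {X : Type} [TopologicalSpace X] {f : (N → I) → X}
    (hf : Continuous f) {b : (N → I) × I → X}
    (hb : ContinuousOn b (Cube.boundary N ×ˢ Set.univ))
    (hb0 : ∀ z ∈ Cube.boundary N, b (z, 0) = f z) :
    ∃ g : (N → I) → X, Continuous g ∧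
      (∀ y, ‖y‖ ≤ 1 / 2 → g (cubeOfBall y) = f (cubeOfBall ((2 : ℝ) • y))) ∧
      ∀ y, 1 / 2 ≤ ‖y‖ → ‖y‖ ≤ 1 → g (cubeOfBall y) =
        b (cubeOfBall (‖y‖⁻¹ • y), Set.projIcc 0 1 zero_le_one (2 * ‖y‖ - 1)) := by
  classical
  let f₁ : (N → I) → X := fun z => f (cubeOfBall ((2 : ℝ) • ballOfCube z))
  let k : (N → I) → (N → I) × I := fun z => (cubeOfBall (‖ballOfCube z‖⁻¹ • ballOfCube z),
    Set.projIcc 0 1 zero_le_one (2 * ‖ballOfCube z‖ - 1))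
  have hcn : Continuous fun z : N → I => ‖ballOfCube z‖ := continuous_ballOfCube.norm
  have hf₁ : Continuous f₁ :=
    hf.comp (continuous_cubeOfBall.comp (continuous_ballOfCube.const_smul (2 : ℝ)))
  have hk : ContinuousOn k {z | 1 / 2 ≤ ‖ballOfCube z‖} := by
    refine ContinuousOn.prodMk ?_ ?_
    · refine continuous_cubeOfBall.comp_continuousOn (ContinuousOn.fun_smul ?_
        continuous_ballOfCube.continuousOn)
      refine hcn.continuousOn.inv₀ fun z hz => ?_
      have : (1 : ℝ) / 2 ≤ ‖ballOfCube z‖ := hz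
      positivity
    · exact (continuous_projIcc.comp (by fun_prop)).continuousOn
  have hkb : Set.MapsTo k {z | 1 / 2 ≤ ‖ballOfCube z‖} (Cube.boundary N ×ˢ Set.univ) := by
    intro z hz
    have : (1 : ℝ) / 2 ≤ ‖ballOfCube z‖ := hz
    exact ⟨cubeOfBall_mem_boundary (norm_inv_norm_smul (by linarith)), trivial⟩
  have hbk : ContinuousOn (b ∘ k) {z | 1 / 2 ≤ ‖ballOfCube z‖} := hb.comp hk hkb
  have hagree : ∀ z, ‖ballOfCube z‖ = 1 / 2 → f₁ z = (b ∘ k) z := by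
    intro z hz
    have h0 : k z = (cubeOfBall ((2 : ℝ) • ballOfCube z), 0) := by
      simp only [k, hz]
      norm_num
    rw [Function.comp_apply, h0, hb0]
    apply cubeOfBall_mem_boundary
    rw [norm_smul, hz]
    norm_num
  refine ⟨fun z => if ‖ballOfCube z‖ ≤ 1 / 2 then f₁ z else (b ∘ k) z,
    continuous_if_le hcn continuous_const hf₁.continuousOn hbk hagree, ?_, ?_⟩
  · intro y hy
    have h1 := ballOfCube_cubeOfBall (hy.trans (by norm_num))
    simp only [h1, if_pos hy, f₁]
  · intro y hy hy1
    have h1 := ballOfCube_cubeOfBall hy1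
    have h2 : (if ‖ballOfCube (cubeOfBall y)‖ ≤ 1 / 2 then f₁ (cubeOfBall y)
        else (b ∘ k) (cubeOfBall y)) = (b ∘ k) (cubeOfBall y) := by
      split_ifs with h
      · exact hagree _ (le_antisymm h (by rwa [h1]))
      · rfl
    refine h2.trans ?_
    simp only [Function.comp_apply, k, h1]

theorem exists_cube_filling {X : Type} [TopologicalSpace X] (x₀ : X)
    (hX : Subsingleton (HomotopyGroup N X x₀)) {f : (N → I) → X} (hf : Continuous f)
    {b : (N → I) × I → X} (hb : ContinuousOn b (Cube.boundary N ×ˢ Set.univ))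
    (hb0 : ∀ z ∈ Cube.boundary N, b (z, 0) = f z) (hb1 : ∀ z ∈ Cube.boundary N, b (z, 1) = x₀) :
    ∃ G : (N → I) × I → X, Continuous G ∧ (∀ z, G (z, 0) = f z) ∧ (∀ z, G (z, 1) = x₀) ∧
      ∀ z ∈ Cube.boundary N, ∀ t, G (z, t) = b (z, t) := by
  classical
  have hcn : Continuous fun z : N → I => ‖ballOfCube z‖ := continuous_ballOfCube.norm
  obtain ⟨g, hg, hg1, hg2⟩ := exists_continuous_collar hf hb hb0
  have hgb : ∀ z ∈ Cube.boundary N, g z = x₀ := by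
    intro z hz
    have h1 := norm_ballOfCube_eq_one_iff.2 hz
    have h2 := hg2 (ballOfCube z) (by rw [h1]; norm_num) h1.le
    rw [cubeOfBall_ballOfCube, h1, inv_one, one_smul, cubeOfBall_ballOfCube] at h2
    rw [h2, ← hb1 z hz]
    norm_num
  let p : GenLoop N X x₀ := ⟨⟨g, hg⟩, hgb⟩
  have hp : GenLoop.Homotopic p GenLoop.const :=
    Quotient.exact (hX.elim (Quotient.mk _ p) (Quotient.mk _ GenLoop.const))
  obtain ⟨Γ⟩ := hp
  have hΓ0 : ∀ z, Γ (0, z) = g z := fun z => Γ.apply_zero z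
  have hΓ1 : ∀ z, Γ (1, z) = x₀ := fun z => Γ.apply_one z
  have hΓb : ∀ t, ∀ z ∈ Cube.boundary N, Γ (t, z) = x₀ := fun t z hz =>
    (Γ.eq_fst t hz).trans (hgb z hz)
  let m : (N → I) → ℝ := fun z => max ‖ballOfCube z‖ (1 / 2)
  have hm : Continuous m := hcn.max continuous_const
  have hm0 : ∀ z, 0 < m z := fun z => lt_of_lt_of_le (by norm_num) (le_max_right _ _)
  let G : (N → I) × I → X := fun q => Γ
    (Set.projIcc 0 1 zero_le_one (q.2 * (2 * (1 - ‖ballOfCube q.1‖))),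
      cubeOfBall (((1 - q.2) / 2 + q.2 * (m q.1)⁻¹ : ℝ) • ballOfCube q.1))
  refine ⟨G, ?_, fun z => ?_, fun z => ?_, fun z hz t => ?_⟩
  · refine Γ.continuous.comp (Continuous.prodMk ?_ ?_)
    · have := hcn.comp (continuous_fst (X := N → I) (Y := I))
      refine continuous_projIcc.comp ?_
      exact (continuous_subtype_val.comp continuous_snd).mul
        (continuous_const.mul (continuous_const.sub this))
    · have h1 : Continuous fun q : (N → I) × I => (m q.1)⁻¹ :=
        (hm.comp continuous_fst).inv₀ fun q => (hm0 _).ne'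
      have h2 := continuous_ballOfCube.comp (continuous_fst (X := N → I) (Y := I))
      refine continuous_cubeOfBall.comp (Continuous.fun_smul ?_ h2)
      fun_prop
  · simp only [G]
    norm_num
    have h1 : ‖((1 / 2 : ℝ) • ballOfCube z)‖ ≤ 1 / 2 := by
      rw [norm_smul]
      have := norm_ballOfCube_le z
      norm_num
      linarith
    change g (cubeOfBall ((1 / 2 : ℝ) • ballOfCube z)) = f z
    rw [hg1 _ h1, smul_smul]
    norm_num [cubeOfBall_ballOfCube]
  · simp only [G]
    rcases le_or_gt (1 / 2) ‖ballOfCube z‖ with h | h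
    · apply hΓb
      apply cubeOfBall_mem_boundary
      have : m z = ‖ballOfCube z‖ := max_eq_left h
      rw [this]
      norm_num
      exact norm_inv_norm_smul (by linarith)
    · rw [Set.projIcc_of_right_le, Set.Icc.mk_one]
      · exact hΓ1 _
      · simp; linarith
  · have h1 := norm_ballOfCube_eq_one_iff.2 hz
    have h2 : m z = 1 := by simp only [m, h1]; norm_num
    simp only [G, h1, h2]
    norm_num
    set r : ℝ := (1 - (t : ℝ)) / 2 + t with hr
    have ht0 := t.2.1
    have ht1 := t.2.2
    have hr0 : 1 / 2 ≤ r := by rw [hr]; linarith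
    have hr1 : r ≤ 1 := by rw [hr]; linarith
    have h3 : ‖r • ballOfCube z‖ = r := by
      rw [norm_smul, h1, Real.norm_of_nonneg (by linarith), mul_one]
    change g (cubeOfBall (r • ballOfCube z)) = b (z, t)
    rw [hg2 _ (by rw [h3]; exact hr0) (by rw [h3]; exact hr1), h3]
    have h5 : Set.projIcc (0 : ℝ) 1 zero_le_one (2 * r - 1) = t := by
      rw [show 2 * r - 1 = (t : ℝ) by rw [hr]; ring]; simp
    have h6 : r⁻¹ • r • ballOfCube z = ballOfCube z := by
      rw [smul_smul, inv_mul_cancel₀ (by linarith), one_smul]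
    rw [h5, h6, cubeOfBall_ballOfCube]

end CubeFilling

theorem subsingleton_homotopyGroup_of_equiv {M N X : Type} [TopologicalSpace X] {x : X} (e : M ≃ N)
    (h : Subsingleton (HomotopyGroup M X x)) : Subsingleton (HomotopyGroup N X x) := by
  have hcont : ∀ {M N : Type} (e : M ≃ N), Continuous fun z : M → I => z ∘ e.symm := fun e =>
    continuous_pi fun i => continuous_apply _
  have hbd : ∀ {M N : Type} (e : M ≃ N) (z : M → I), z ∈ Cube.boundary M →
      z ∘ e.symm ∈ Cube.boundary N := by
    rintro M N e z ⟨i, hi⟩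
    exact ⟨e i, by simpa using hi⟩
  let r : GenLoop N X x → GenLoop M X x := fun p =>
    ⟨⟨fun z => p (z ∘ e.symm), (map_continuous p.1).comp (hcont e)⟩, fun z hz => p.2 _ (hbd e z hz)⟩
  refine ⟨fun p q => Quotient.inductionOn₂ p q fun p q => Quotient.sound ?_⟩
  obtain ⟨Γ⟩ : GenLoop.Homotopic (r p) (r q) :=
    Quotient.exact (h.elim (Quotient.mk _ (r p)) (Quotient.mk _ (r q)))
  have hez : ∀ z : N → I, (z ∘ e) ∘ e.symm = z := fun z => by ext; simp
  refine ⟨⟨⟨⟨fun s => Γ (s.1, s.2 ∘ e), ?_⟩, fun z => ?_, fun z => ?_⟩, fun t z hz => ?_⟩⟩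
  · exact Γ.continuous.comp (continuous_fst.prodMk ((hcont e.symm).comp continuous_snd))
  · exact (Γ.apply_zero _).trans (congrArg p (hez z))
  · exact (Γ.apply_one _).trans (congrArg q (hez z))
  · exact (Γ.eq_fst t (hbd e.symm z hz)).trans (congrArg p (hez z))

section Cubical

variable {U : Type}

/-- The points of the unit cube of `U → ℝ` that are `1` on `e.1` and vanish outside `e.1 ∪ e.2`. -/
def cubeCell (e : Finset U × Finset U) : Set (U → ℝ) :=
  {w | (∀ u, w u ∈ I) ∧ (∀ u ∈ e.1, w u = 1) ∧ ∀ u, u ∉ e.1 → u ∉ e.2 → w u = 0}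

theorem isClosed_cubeCell (e : Finset U × Finset U) : IsClosed (cubeCell e) := by
  have : cubeCell e = (⋂ u, {w : U → ℝ | w u ∈ I}) ∩
      ((⋂ u, ⋂ (_ : u ∈ e.1), {w : U → ℝ | w u = 1}) ∩
      ⋂ u, ⋂ (_ : u ∉ e.1), ⋂ (_ : u ∉ e.2), {w : U → ℝ | w u = 0}) := by
    ext x; simp [cubeCell]
  rw [this]
  refine (isClosed_iInter fun u => isClosed_Icc.preimage (continuous_apply u)).inter
    ((isClosed_iInter fun u => isClosed_iInter fun _ => ?_).inter
      (isClosed_iInter fun u => isClosed_iInter fun _ => isClosed_iInter fun _ => ?_)) <;>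
  exact isClosed_eq (continuous_apply u) continuous_const

/-- The retraction onto `cubeCell e`, in cube coordinates. -/
noncomputable def cellCoord (e : Finset U × Finset U) (w : U → ℝ) : e.2 → I :=
  fun u => Set.projIcc 0 1 zero_le_one (w u)

theorem continuous_cellCoord (e : Finset U × Finset U) : Continuous (cellCoord e) :=
  continuous_pi fun _ => continuous_projIcc.comp (continuous_apply _)

variable [DecidableEq U]

/-- The parametrization of `cubeCell e` by a cube. -/
noncomputable def cellMap (e : Finset U × Finset U) (z : e.2 → I) : U → ℝ :=
  fun u => if u ∈ e.1 then 1 else if h : u ∈ e.2 then z ⟨u, h⟩ else 0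

theorem continuous_cellMap (e : Finset U × Finset U) : Continuous (cellMap e) := by
  refine continuous_pi fun u => ?_
  unfold cellMap
  split_ifs
  · exact continuous_const
  · exact continuous_subtype_val.comp (continuous_apply _)
  · exact continuous_const

theorem cellMap_mem (e : Finset U × Finset U) (z : e.2 → I) : cellMap e z ∈ cubeCell e := by
  refine ⟨fun u => ?_, fun u hu => by simp [cellMap, hu], fun u h1 h2 => by simp [cellMap, h1, h2]⟩
  unfold cellMap
  split_ifs
  · simp
  · exact (z _).2
  · simp

theorem cellMap_cellCoord {e : Finset U × Finset U} {w : U → ℝ} (hw : w ∈ cubeCell e) :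
    cellMap e (cellCoord e w) = w := by
  ext u
  unfold cellMap
  split_ifs with h1 h2
  · exact (hw.2.1 u h1).symm
  · rw [cellCoord, Set.projIcc_of_mem _ (hw.1 u)]
  · exact (hw.2.2 u h1 h2).symm

/-- Every map from a finite cubical complex of dimension at most `d` to a `d`-connected space is
null-homotopic. -/
theorem exists_cubical_nullhomotopy {X : Type} [TopologicalSpace X] {d : ℤ} (x₀ : X)
    (hX : ∀ i : ℕ, (i : ℤ) ≤ d → Subsingleton (HomotopyGroup (Fin i) X x₀))
    (D : Finset (Finset U × Finset U)) (hdisj : ∀ e ∈ D, Disjoint e.1 e.2)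
    (hcard : ∀ e ∈ D, (e.2.card : ℤ) ≤ d)
    (hdown : ∀ e ∈ D, ∀ u ∈ e.2, (e.1, e.2.erase u) ∈ D ∧ (insert u e.1, e.2.erase u) ∈ D)
    (f : (U → ℝ) → X) (hf : ContinuousOn f (⋃ e ∈ D, cubeCell e)) :
    ∃ H : (U → ℝ) × I → X, ContinuousOn H ((⋃ e ∈ D, cubeCell e) ×ˢ Set.univ) ∧
      ∀ w ∈ ⋃ e ∈ D, cubeCell e, H (w, 0) = f w ∧ H (w, 1) = x₀ := by
  classical
  obtain ⟨k, hk⟩ : ∃ k, D.card = k := ⟨_, rfl⟩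
  induction k generalizing D with
  | zero =>
    rw [Finset.card_eq_zero] at hk
    subst hk
    exact ⟨fun _ => x₀, by simp, by simp⟩
  | succ k ih =>
    obtain ⟨e, he, hmax⟩ := D.exists_max_image (fun e => e.2.card)
      (Finset.card_pos.1 (by omega))
    set D' := D.erase e with hD'
    have hDD : (⋃ e ∈ D, cubeCell e) = (⋃ e ∈ D', cubeCell e) ∪ cubeCell e := by
      rw [← Finset.insert_erase he, Finset.set_biUnion_insert, Set.union_comm]
    have herase : ∀ e' ∈ D, ∀ u ∈ e'.2, ∀ A, (A, e'.2.erase u) ≠ e := by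
      rintro e' h' u hu A rfl
      have := hmax e' h'
      have := Finset.card_erase_lt_of_mem hu
      simp only at *
      omega
    obtain ⟨H, hH, hH01⟩ := ih D' (fun e' h' => hdisj e' (Finset.mem_of_mem_erase h'))
      (fun e' h' => hcard e' (Finset.mem_of_mem_erase h'))
      (fun e' h' u hu => by
        have h'' := Finset.mem_of_mem_erase h'
        exact ⟨Finset.mem_erase.2 ⟨herase e' h'' u hu _, (hdown e' h'' u hu).1⟩,
          Finset.mem_erase.2 ⟨herase e' h'' u hu _, (hdown e' h'' u hu).2⟩⟩)
      (hf.mono (by rw [hDD]; exact Set.subset_union_left))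
      (by rw [hD', Finset.card_erase_of_mem he]; omega)
    have hbd : ∀ z ∈ Cube.boundary e.2, cellMap e z ∈ ⋃ e ∈ D', cubeCell e := by
      rintro z ⟨u, hu⟩
      have hm := cellMap_mem e z
      have hue : (u : U) ∉ e.1 := Finset.disjoint_right.1 (hdisj e he) u.2
      have hval : cellMap e z u = z u := by simp [cellMap, hue]
      rw [Set.mem_iUnion₂]
      rcases hu with hu | hu
      · refine ⟨_, Finset.mem_erase.2 ⟨herase e he u u.2 _, (hdown e he u u.2).1⟩, hm.1, hm.2.1, ?_⟩
        intro v hv hv'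
        by_cases hvu : v = u
        · rw [hvu, hval, hu]; rfl
        · exact hm.2.2 v hv fun h => hv' (Finset.mem_erase.2 ⟨hvu, h⟩)
      · refine ⟨_, Finset.mem_erase.2 ⟨herase e he u u.2 _, (hdown e he u u.2).2⟩, hm.1, ?_, ?_⟩
        · intro v hv
          rcases Finset.mem_insert.1 hv with rfl | hv
          · rw [hval, hu]; rfl
          · exact hm.2.1 v hv
        · intro v hv hv'
          refine hm.2.2 v (fun h => hv (Finset.mem_insert_of_mem h)) fun h => hv' ?_
          exact Finset.mem_erase.2 ⟨fun h' => hv (by simp [h']), h⟩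
    have hinter : ∀ w ∈ cubeCell e, w ∈ (⋃ e ∈ D', cubeCell e) →
        cellCoord e w ∈ Cube.boundary e.2 := by
      intro w hw hw'
      obtain ⟨e', he', hwe'⟩ := Set.mem_iUnion₂.1 hw'
      by_contra hb
      have hopen : ∀ u ∈ e.2, w u ≠ 0 ∧ w u ≠ 1 := by
        intro u hu
        have h1 : ∀ t : I, w u = t → cellCoord e w ⟨u, hu⟩ = t := by
          intro t ht
          simp [cellCoord, ht]
        exact ⟨fun h => hb ⟨⟨u, hu⟩, Or.inl (h1 0 h)⟩, fun h => hb ⟨⟨u, hu⟩, Or.inr (h1 1 h)⟩⟩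
      have h1 : e'.1 ⊆ e.1 := by
        intro u hu
        have h2 := hwe'.2.1 u hu
        by_contra h3
        by_cases h4 : u ∈ e.2
        · exact (hopen u h4).2 h2
        · rw [hw.2.2 u h3 h4] at h2; exact zero_ne_one h2
      have h2 : e.2 ⊆ e'.2 := by
        intro u hu
        by_contra h3
        by_cases h4 : u ∈ e'.1
        · exact (hopen u hu).2 (hwe'.2.1 u h4)
        · exact (hopen u hu).1 (hwe'.2.2 u h4 h3)
      have h3 : e.2 = e'.2 :=
        Finset.eq_of_subset_of_card_le h2 (hmax e' (Finset.mem_of_mem_erase he'))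
      have h4 : e.1 ⊆ e'.1 := by
        intro u hu
        have h5 := hw.2.1 u hu
        by_contra h6
        have h7 : u ∉ e'.2 := h3 ▸ Finset.disjoint_left.1 (hdisj e he) hu
        rw [hwe'.2.2 u h6 h7] at h5
        exact zero_ne_one h5
      exact (Finset.mem_erase.1 he').1 (Prod.ext (h1.antisymm h4) h3.symm)
    have hπ : Subsingleton (HomotopyGroup e.2 X x₀) :=
      subsingleton_homotopyGroup_of_equiv e.2.equivFin.symm (hX _ (hcard e he))
    have hfe : Continuous fun z => f (cellMap e z) := by
      refine hf.comp_continuous (continuous_cellMap e) fun z => ?_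
      rw [hDD]
      exact Or.inr (cellMap_mem e z)
    obtain ⟨G, hG, hG0, hG1, hGb⟩ := exists_cube_filling x₀ hπ hfe
      (b := fun q => H (cellMap e q.1, q.2))
      (hH.comp (((continuous_cellMap e).comp continuous_fst).prodMk continuous_snd).continuousOn
        fun q hq => ⟨hbd q.1 hq.1, trivial⟩)
      (fun z hz => (hH01 _ (hbd z hz)).1) (fun z hz => (hH01 _ (hbd z hz)).2)
    let H' : (U → ℝ) × I → X := fun q =>
      if q.1 ∈ cubeCell e then G (cellCoord e q.1, q.2) else H q
    have h1 : ∀ q : (U → ℝ) × I, q.1 ∈ cubeCell e → H' q = G (cellCoord e q.1, q.2) :=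
      fun q hq => if_pos hq
    have h2 : ∀ q : (U → ℝ) × I, q.1 ∈ (⋃ e ∈ D', cubeCell e) → H' q = H q := by
      intro q hq
      by_cases h : q.1 ∈ cubeCell e
      · rw [h1 q h, hGb _ (hinter _ h hq), cellMap_cellCoord h]
      · exact if_neg h
    refine ⟨H', ?_, ?_⟩
    · rw [hDD, Set.union_prod]
      refine ContinuousOn.union_of_isClosed ?_ ?_ ?_ ?_
      · exact hH.congr fun q hq => h2 q hq.1
      · refine ContinuousOn.congr (f := fun q => G (cellCoord e q.1, q.2)) ?_ fun q hq => h1 q hq.1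
        exact (hG.comp (((continuous_cellCoord e).comp continuous_fst).prodMk
          continuous_snd)).continuousOn
      · exact (D'.finite_toSet.isClosed_biUnion fun e _ => isClosed_cubeCell e).prod isClosed_univ
      · exact (isClosed_cubeCell e).prod isClosed_univ
    · intro w hw
      rw [hDD] at hw
      rcases hw with hw | hw
      · rw [h2 _ hw, h2 _ hw]; exact hH01 w hw
      · rw [h1 _ hw, h1 _ hw, hG0, hG1, cellMap_cellCoord hw]
        exact ⟨rfl, rfl⟩

end Cubical

namespace ASC

/-- A map from a finite simplicial complex of dimension at most `d` to a `d`-connected space is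
null-homotopic. -/
theorem exists_nullhomotopy {U X : Type} [Fintype U] [DecidableEq U] [TopologicalSpace X] {d : ℤ}
    (L : ASC U) (hL : ∀ s ∈ L.faces, (s.card : ℤ) ≤ d + 1) (x₀ : X)
    (hX : ∀ i : ℕ, (i : ℤ) ≤ d → Subsingleton (HomotopyGroup (Fin i) X x₀)) (F : C(L.space, X)) :
    ∃ H : C(L.space × I, X), (∀ y, H (y, 0) = F y) ∧ ∀ y, H (y, 1) = x₀ := by
  classical
  let D : Finset (Finset U × Finset U) :=
    Finset.univ.filter fun e => e.1.Nonempty ∧ Disjoint e.1 e.2 ∧ e.1 ∪ e.2 ∈ L.faces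
  let r : (U → ℝ) → U → ℝ := fun w => (∑ u, w u)⁻¹ • w
  let f : (U → ℝ) → X := fun w => if h : r w ∈ L.space then F ⟨r w, h⟩ else x₀
  have hpos : ∀ e ∈ D, ∀ w ∈ cubeCell e, 0 < ∑ u, w u := by
    intro e he w hw
    obtain ⟨u, hu⟩ := (Finset.mem_filter.1 he).2.1
    refine Finset.sum_pos' (fun v _ => (hw.1 v).1) ⟨u, Finset.mem_univ _, ?_⟩
    rw [hw.2.1 u hu]
    exact zero_lt_one
  have hr : ∀ e ∈ D, ∀ w ∈ cubeCell e, r w ∈ L.space := by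
    intro e he w hw
    have h0 := hpos e he w hw
    refine mem_space_iff.2 ⟨_, (Finset.mem_filter.1 he).2.2.2, fun u => ?_, fun u hu => ?_, ?_⟩
    · exact mul_nonneg (inv_nonneg.2 h0.le) (hw.1 u).1
    · rw [Finset.mem_union, not_or] at hu
      simp [r, hw.2.2 u hu.1 hu.2]
    · simp only [r, Pi.smul_apply, smul_eq_mul, ← Finset.mul_sum]
      rw [Finset.sum_subset (Finset.subset_univ (e.1 ∪ e.2)), inv_mul_cancel₀ h0.ne']
      intro u _ hu
      rw [Finset.mem_union, not_or] at hu
      exact hw.2.2 u hu.1 hu.2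
  have hf : ContinuousOn f (⋃ e ∈ D, cubeCell e) := by
    rw [continuousOn_iff_continuous_domRestrict]
    have hrw : ∀ w : ↥(⋃ e ∈ D, cubeCell e), r w ∈ L.space := fun w => by
      obtain ⟨e, he, hw⟩ := Set.mem_iUnion₂.1 w.2
      exact hr e he _ hw
    have : (⋃ e ∈ D, cubeCell e).domRestrict f =
        fun w : ↥(⋃ e ∈ D, cubeCell e) => F ⟨r w, hrw w⟩ := by
      ext w
      exact dif_pos (hrw w)
    rw [this]
    refine F.continuous.comp (Continuous.subtype_mk ?_ _)
    refine Continuous.fun_smul (Continuous.inv₀ (by fun_prop) fun w => ?_) continuous_subtype_val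
    obtain ⟨e, he, hw⟩ := Set.mem_iUnion₂.1 w.2
    exact (hpos e he _ hw).ne'
  obtain ⟨H, hH, hH01⟩ := exists_cubical_nullhomotopy x₀ hX D
    (fun e he => (Finset.mem_filter.1 he).2.2.1)
    (fun e he => by
      obtain ⟨-, h1, h2, h3⟩ := Finset.mem_filter.1 he
      have := hL _ h3
      rw [Finset.card_union_of_disjoint h2] at this
      have := h1.card_pos
      push_cast at *
      omega)
    (fun e he u hu => by
      obtain ⟨-, h1, h2, h3⟩ := Finset.mem_filter.1 he
      refine ⟨Finset.mem_filter.2 ⟨Finset.mem_univ _, h1, ?_, ?_⟩,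
        Finset.mem_filter.2 ⟨Finset.mem_univ _, by simp, ?_, ?_⟩⟩
      · exact h2.mono_right (Finset.erase_subset _ _)
      · exact L.down_closed h3 (Finset.union_subset_union_right (Finset.erase_subset _ _))
          (h1.mono Finset.subset_union_left)
      · rw [Finset.disjoint_insert_left]
        exact ⟨by simp, h2.mono_right (Finset.erase_subset _ _)⟩
      · convert h3 using 1
        ext v
        by_cases hv : v = u <;> simp [hv, hu])
    f hf
  let s : (U → ℝ) → U → ℝ := fun y => ‖y‖⁻¹ • y
  have hs0 : ∀ y ∈ L.space, 0 < ‖y‖ := by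
    intro y hy
    obtain ⟨u, hu⟩ := exists_pos_of_mem_space hy
    exact hu.trans_le ((le_abs_self _).trans (norm_le_pi_norm y u))
  have hsD : ∀ y ∈ L.space, s y ∈ ⋃ e ∈ D, cubeCell e := by
    intro y hy
    have h0 := hs0 y hy
    have hy0 := hy.1
    have hle : ∀ u, y u ≤ ‖y‖ := fun u => (le_abs_self _).trans (norm_le_pi_norm y u)
    refine Set.mem_iUnion₂.2 ⟨(Finset.univ.filter fun u => y u = ‖y‖,
      Finset.univ.filter fun u => 0 < y u ∧ y u ≠ ‖y‖), ?_, fun u => ⟨?_, ?_⟩, fun u hu => ?_,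
      fun u h1 h2 => ?_⟩
    · have hne : (Finset.univ.filter fun u => y u = ‖y‖).Nonempty := by
        by_contra hne
        rw [Finset.not_nonempty_iff_eq_empty, Finset.filter_eq_empty_iff] at hne
        have : ‖y‖ < ‖y‖ := by
          rw [pi_norm_lt_iff h0]
          intro u
          rw [Real.norm_of_nonneg (hy0 u)]
          exact lt_of_le_of_ne (hle u) (hne (Finset.mem_univ u))
        exact lt_irrefl _ this
      refine Finset.mem_filter.2 ⟨Finset.mem_univ _, hne, ?_, ?_⟩
      · rw [Finset.disjoint_left]
        intro u h1 h2
        exact (Finset.mem_filter.1 h2).2.2 (Finset.mem_filter.1 h1).2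
      · refine mem_faces_of_pos hy (hne.mono Finset.subset_union_left) fun u hu => ?_
        rcases Finset.mem_union.1 hu with hu | hu
        · rw [(Finset.mem_filter.1 hu).2]; exact h0
        · exact (Finset.mem_filter.1 hu).2.1
    · exact mul_nonneg (inv_nonneg.2 h0.le) (hy0 u)
    · change ‖y‖⁻¹ * y u ≤ 1
      rw [inv_mul_le_iff₀ h0, mul_one]
      exact hle u
    · change ‖y‖⁻¹ * y u = 1
      rw [(Finset.mem_filter.1 hu).2, inv_mul_cancel₀ h0.ne']
    · have : y u = 0 := by
        by_contra h
        simp only [Finset.mem_filter, Finset.mem_univ, true_and] at h1 h2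
        exact h2 ⟨lt_of_le_of_ne (hy0 u) (Ne.symm h), h1⟩
      simp [s, this]
  have hrs : ∀ y ∈ L.space, r (s y) = y := by
    intro y hy
    have h0 := hs0 y hy
    obtain ⟨-, t, ht, h1, h2⟩ := hy
    have hsum : ∑ u, y u = 1 := by
      rw [← h2]
      exact (Finset.sum_subset (Finset.subset_univ t) fun u _ hu => h1 u hu).symm
    simp only [r, s, Pi.smul_apply, smul_eq_mul, ← Finset.mul_sum, hsum, mul_one, inv_inv]
    rw [smul_smul, mul_inv_cancel₀ h0.ne', one_smul]
  refine ⟨⟨fun q => H (s q.1, q.2), ?_⟩, fun y => ?_, fun y => (hH01 _ (hsD y y.2)).2⟩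
  · refine hH.comp_continuous (Continuous.prodMk ?_ continuous_snd) fun q => ⟨hsD _ q.1.2, trivial⟩
    have h1 : Continuous fun q : L.space × I => (q.1 : U → ℝ) :=
      continuous_subtype_val.comp continuous_fst
    exact Continuous.fun_smul (h1.norm.inv₀ fun q => (hs0 _ q.1.2).ne') h1
  · refine (hH01 _ (hsD y y.2)).1.trans ?_
    have : r (s y) ∈ L.space := by rw [hrs y y.2]; exact y.2
    simp only [f, dif_pos this]
    congr 1
    exact Subtype.ext (hrs y y.2)

end ASC

namespace ASC

variable {V : Type} [DecidableEq V]

theorem push_apply {W : Type} (φ : W → V) {x : W → ℝ} {s : Finset W} (hx : ∀ w, w ∉ s → x w = 0)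
    (v : V) : push φ x v = ∑ w ∈ s, if φ w = v then x w else 0 := by
  rw [push, finsum_mem_def, finsum_eq_sum_of_support_subset (s := s)]
  · refine Finset.sum_congr rfl fun w _ => ?_
    by_cases h : φ w = v <;> simp [h]
  · intro w hw
    by_contra h
    exact hw (by simp [hx w h])

theorem push_mem_space {W : Type} {M : ASC W} {K : ASC V} {φ : W → V}
    (hφ : ∀ s ∈ M.faces, s.image φ ∈ K.faces)
    {x : W → ℝ} (hx : x ∈ M.space) : push φ x ∈ K.space := by
  obtain ⟨h0, s, hs, h1, h2⟩ := hx
  refine ⟨fun v => ?_, s.image φ, hφ s hs, fun v hv => ?_, ?_⟩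
  · rw [push_apply φ h1]
    exact Finset.sum_nonneg fun w _ => by split_ifs <;> simp [h0]
  · rw [push_apply φ h1]
    refine Finset.sum_eq_zero fun w hw => if_neg ?_
    rintro rfl
    exact hv (Finset.mem_image_of_mem _ hw)
  · simp_rw [push_apply φ h1]
    rw [Finset.sum_comm, ← h2]
    refine Finset.sum_congr rfl fun w hw => ?_
    rw [Finset.sum_ite_eq, if_pos (Finset.mem_image_of_mem _ hw)]

theorem continuous_push {U : Type} [Fintype U] (φ : U → V) : Continuous (push φ) := by
  have : push φ = fun x v => ∑ u, if φ u = v then x u else 0 := by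
    ext x v
    exact push_apply φ (by simp) v
  rw [this]
  refine continuous_pi fun v => continuous_finsetSum _ fun u _ => ?_
  split_ifs
  · exact continuous_apply u
  · exact continuous_const

theorem fillConn_of_isConn (K : ASC V) (d : ℤ) (hd : -1 ≤ d) (hK : IsConn K.space d) :
    FillConn K d := by
  intro A c L ψ hcA _ hLA hcard hψ
  obtain ⟨x₀⟩ := hK.1 hd
  let L₀ : ASC A :=
    { faces := {s | s.map (Function.Embedding.subtype _) ∈ L.faces}
      nonempty_of_mem := fun s hs => by simpa using L.nonempty_of_mem hs
      down_closed := fun s t hs hts ht =>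
        L.down_closed hs (Finset.map_subset_map.2 hts) (by simpa using ht) }
  let ψ₀ : A → V := fun u => ψ u
  have hψ₀ : L₀.IsSimplicial K ψ₀ := by
    intro s hs
    have := hψ _ hs
    rwa [Finset.map_eq_image, Finset.image_image] at this
  let F : C(L₀.space, K.space) := ⟨fun y => ⟨push ψ₀ y, push_mem_space hψ₀ y.2⟩,
    ((continuous_push ψ₀).comp continuous_subtype_val).subtype_mk _⟩
  obtain ⟨H, H0, H1⟩ := exists_nullhomotopy L₀ (fun s hs => by
    have := hcard _ hs
    rwa [Finset.card_map] at this) x₀ (fun i hi => hK.2 i hi x₀) F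
  have hfill := fillAll_of_homotopy hψ₀ H x₀ (fun y => by rw [H0]; rfl) H1 c
  refine hfill A L ψ (fun w u => if (u : ℕ) = w then 1 else 0) ⟨hcA, hLA, fun s hs => ?_, ?_⟩
  · have hs' : (s.subtype (· ∈ A)).map (Function.Embedding.subtype _) = s :=
      Finset.subtype_map_of_mem (hLA s hs)
    refine ⟨s.subtype (· ∈ A), by change _ ∈ L.faces; rwa [hs'], ?_⟩
    rintro _ ⟨w, hw, rfl⟩
    have hwA := hLA s hs hw
    refine ⟨fun u => ?_, fun u hu => ?_, ?_⟩
    · change (0 : ℝ) ≤ if (u : ℕ) = w then 1 else 0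
      split_ifs <;> simp
    · refine if_neg fun h => hu ?_
      rw [Finset.mem_subtype, h]
      exact hw
    · rw [Finset.sum_eq_single ⟨w, hwA⟩]
      · simp
      · rintro u - hu
        exact if_neg fun h => hu (Subtype.ext h)
      · intro h
        exact absurd (Finset.mem_subtype.2 hw) h
  · intro s hs w hw
    exact ⟨⟨w, hLA s hs hw⟩, rfl, by simp⟩

end ASC

end Nullhomotopies

namespace ASC

variable {V U : Type} [DecidableEq V]

theorem affineExt_apply (pos : ℕ → U → ℝ) {x : ℕ → ℝ} {s : Finset ℕ} (hx : ∀ w, w ∉ s → x w = 0)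
    (u : U) : affineExt pos x u = ∑ w ∈ s, x w * pos w u := by
  rw [affineExt, finsum_eq_sum_of_support_subset]
  intro w hw
  by_contra h
  exact hw (by simp [hx w h])

theorem affineExt_mem_simplexSet {pos : ℕ → U → ℝ} {x : ℕ → ℝ} {s : Finset ℕ} {e : Finset U}
    (hx : x ∈ simplexSet s) (h : pos '' s ⊆ simplexSet e) : affineExt pos x ∈ simplexSet e := by
  have : affineExt pos x = ∑ w ∈ s, x w • pos w := by
    ext u
    rw [affineExt_apply pos hx.2.1]
    simp
  rw [this]
  exact (convex_simplexSet e).sum_mem (fun w _ => hx.1 w) hx.2.2 fun w hw => h ⟨w, hw, rfl⟩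

theorem mem_simplexSet_of_mem_space {K : ASC V} {x : V → ℝ} (hx : x ∈ K.space) {e : Finset V}
    (he : ∀ v, v ∉ e → x v = 0) : x ∈ simplexSet e := by
  obtain ⟨h0, s, -, h1, h2⟩ := hx
  refine ⟨h0, he, ?_⟩
  rw [← h2, Finset.sum_subset (Finset.subset_union_left (s₂ := s)) fun v _ hv => he v hv,
    Finset.sum_subset (Finset.subset_union_right (s₁ := e)) fun v _ hv => h1 v hv]

/-- The face spanned by the support of a point. -/
theorem exists_support {K : ASC V} {x : V → ℝ} (hx : x ∈ K.space) :
    ∃ s ∈ K.faces, x ∈ simplexSet s ∧ ∀ v ∈ s, 0 < x v := by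
  have hx' := hx
  obtain ⟨h0, s, -, h1, -⟩ := hx
  obtain ⟨v, hv⟩ := exists_pos_of_mem_space hx'
  have hsup : ∀ v, v ∉ s.filter (0 < x ·) → x v = 0 := by
    intro v hv
    by_cases hvs : v ∈ s
    · simp only [Finset.mem_filter, hvs, true_and, not_lt] at hv
      exact le_antisymm hv (h0 v)
    · exact h1 v hvs
  refine ⟨s.filter (0 < x ·), mem_faces_of_pos hx' ⟨v, ?_⟩ fun v hv => (Finset.mem_filter.1 hv).2,
    mem_simplexSet_of_mem_space hx' hsup, fun v hv => (Finset.mem_filter.1 hv).2⟩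
  by_contra h
  exact hv.ne' (hsup v h)

theorem push_eq_zero {W : Type} {φ : W → V} {x : W → ℝ} {s : Finset W} (hx : ∀ w, w ∉ s → x w = 0)
    {v : V} (hv : v ∉ s.image φ) : push φ x v = 0 := by
  rw [push_apply φ hx]
  refine Finset.sum_eq_zero fun w hw => if_neg ?_
  rintro rfl
  exact hv (Finset.mem_image_of_mem _ hw)

theorem homotopicRel_of_common_face {X : Type} [TopologicalSpace X] {K : ASC V}
    (F F' : C(X, K.space)) {S : Set X}
    (h : ∀ x, ∃ e ∈ K.faces, ∀ v, v ∉ e → (F x : V → ℝ) v = 0 ∧ (F' x : V → ℝ) v = 0)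
    (hS : ∀ x ∈ S, (F x : V → ℝ) = F' x) : F.HomotopicRel F' S := by
  have hmem : ∀ z : unitInterval × X,
      (1 - (z.1 : ℝ)) • (F z.2 : V → ℝ) + (z.1 : ℝ) • (F' z.2 : V → ℝ) ∈ K.space := by
    rintro ⟨t, x⟩
    obtain ⟨e, he, h0⟩ := h x
    refine mem_space_iff.2 ⟨e, he, convex_simplexSet e
      (mem_simplexSet_of_mem_space (F x).2 fun v hv => (h0 v hv).1)
      (mem_simplexSet_of_mem_space (F' x).2 fun v hv => (h0 v hv).2)
      (sub_nonneg.2 t.2.2) t.2.1 (by ring)⟩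
  refine ⟨⟨⟨⟨fun z => ⟨_, hmem z⟩, Continuous.subtype_mk ?_ _⟩, ?_, ?_⟩, ?_⟩⟩
  · fun_prop
  · intro x
    ext v
    simp
  · intro x
    ext v
    simp
  · intro t x hx
    ext v
    simp only [ContinuousMap.coe_mk, Pi.add_apply, Pi.smul_apply, smul_eq_mul, ← hS x hx]
    ring

section Collapse

variable {N : ASC ℕ} {σ : Finset ℕ} {a : ℕ}

/-- Replaces the coordinate at `a` by equal shares at the vertices of `σ`. -/
noncomputable def collapse (σ : Finset ℕ) (a : ℕ) (y : ℕ → ℝ) : ℕ → ℝ :=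
  fun w => if w = a then 0 else y w + if w ∈ σ then y a / σ.card else 0

theorem collapse_eq_self {y : ℕ → ℝ} (h : y a = 0) : collapse σ a y = y := by
  ext w
  by_cases hw : w = a <;> simp [collapse, hw, h]

theorem collapse_mem_simplexSet (hσ : σ.Nonempty) (haσ : a ∉ σ) {y : ℕ → ℝ} {t : Finset ℕ}
    (hat : a ∈ t) (hy : y ∈ simplexSet t) : collapse σ a y ∈ simplexSet (t.erase a ∪ σ) := by
  have hc : (σ.card : ℝ) ≠ 0 := by exact_mod_cast hσ.card_pos.ne'
  have hne : ∀ w ∈ t.erase a ∪ σ, w ≠ a := by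
    rintro w hw rfl
    simp [haσ] at hw
  refine ⟨fun w => ?_, fun w hw => ?_, ?_⟩
  · rw [collapse]
    have := hy.1 w
    have := hy.1 a
    split_ifs <;> positivity
  · simp only [Finset.mem_union, Finset.mem_erase, not_or, not_and] at hw
    rw [collapse]
    by_cases hwa : w = a
    · simp [hwa]
    · simp [hwa, hw.2, hy.2.1 w (hw.1 hwa)]
  · have h1 : ∑ w ∈ t.erase a ∪ σ, y w = ∑ w ∈ t.erase a, y w := by
      refine (Finset.sum_subset Finset.subset_union_left fun w hw hw' => hy.2.1 w fun h => ?_).symm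
      exact hw' (Finset.mem_erase.2 ⟨hne w hw, h⟩)
    have h2 : ∑ w ∈ t.erase a ∪ σ, collapse σ a y w =
        ∑ w ∈ t.erase a ∪ σ, (y w + if w ∈ σ then y a / σ.card else 0) :=
      Finset.sum_congr rfl fun w hw => if_neg (hne w hw)
    rw [h2, Finset.sum_add_distrib, h1, Finset.sum_ite_mem,
      Finset.inter_eq_right.2 Finset.subset_union_right, Finset.sum_const, nsmul_eq_mul,
      mul_div_cancel₀ _ hc, Finset.sum_erase_add _ _ hat, hy.2.2]

theorem affineExt_update (pos : ℕ → U → ℝ) (haσ : a ∉ σ) {y : ℕ → ℝ} {t : Finset ℕ}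
    (hy : ∀ w, w ∉ t → y w = 0) :
    affineExt (Function.update pos a (∑ w ∈ σ, (1 / σ.card : ℝ) • pos w)) y =
      affineExt pos (collapse σ a y) := by
  ext u
  have hne : ∀ w ∈ t.erase a ∪ σ, w ≠ a := by
    rintro w hw rfl
    simp [haσ] at hw
  rw [affineExt_apply (s := insert a (t.erase a ∪ σ)), affineExt_apply (s := t.erase a ∪ σ),
    Finset.sum_insert (by simp [haσ]), Function.update_self]
  · have h2 : ∑ w ∈ t.erase a ∪ σ, collapse σ a y w * pos w u =
        ∑ w ∈ t.erase a ∪ σ, (y w * pos w u + if w ∈ σ then y a / σ.card * pos w u else 0) := by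
      refine Finset.sum_congr rfl fun w hw => ?_
      rw [collapse, if_neg (hne w hw)]
      split_ifs <;> ring
    have h3 : ∑ w ∈ t.erase a ∪ σ,
        y w * Function.update pos a (∑ w ∈ σ, (1 / σ.card : ℝ) • pos w) w u =
        ∑ w ∈ t.erase a ∪ σ, y w * pos w u :=
      Finset.sum_congr rfl fun w hw => by rw [Function.update_of_ne (hne w hw)]
    rw [h2, h3, Finset.sum_add_distrib, Finset.sum_ite_mem,
      Finset.inter_eq_right.2 Finset.subset_union_right, add_comm]
    congr 1
    rw [Finset.sum_apply, Finset.mul_sum]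
    refine Finset.sum_congr rfl fun w _ => ?_
    simp only [Pi.smul_apply, smul_eq_mul]
    ring
  · intro w hw
    simp only [Finset.mem_union, Finset.mem_erase, not_or, not_and] at hw
    rw [collapse]
    by_cases hwa : w = a
    · simp [hwa]
    · simp [hwa, hw.2, hy w (hw.1 hwa)]
  · intro w hw
    simp only [Finset.mem_insert, Finset.mem_union, Finset.mem_erase, not_or, not_and] at hw
    exact hy w (hw.2.1 hw.1)

theorem bijOn_collapse (hσ : σ ∈ N.faces) (ha : {a} ∉ N.faces) :
    Set.BijOn (collapse σ a) (stellar N σ a).space N.space := by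
  have hσ' := N.nonempty_of_mem hσ
  have hc : (0 : ℝ) < σ.card := by exact_mod_cast hσ'.card_pos
  have haN : ∀ {s}, s ∈ N.faces → a ∉ s := fun hs => Sub.not_mem_of_singleton ha hs
  have haσ := haN hσ
  refine ⟨?_, ?_, ?_⟩
  · intro y hy
    obtain ⟨t, ⟨h1, h2, h3⟩ | ⟨h1, h2, h3⟩, hyt⟩ := mem_space_iff.1 hy
    · rw [collapse_eq_self (hyt.2.1 a h1)]
      exact mem_space_iff.2 ⟨t, h2, hyt⟩
    · exact mem_space_iff.2 ⟨_, h3, collapse_mem_simplexSet hσ' haσ h1 hyt⟩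
  · have key : ∀ y₁ ∈ (stellar N σ a).space, ∀ y₂ ∈ (stellar N σ a).space,
        collapse σ a y₁ = collapse σ a y₂ → y₁ a ≤ y₂ a := by
      intro y₁ hy₁ y₂ hy₂ h
      obtain ⟨t, ht, hyt⟩ := mem_space_iff.1 hy₂
      obtain ⟨w, hw, hwt⟩ : ∃ w ∈ σ, w ∉ t := by
        have : ¬ σ ⊆ t := by
          rcases ht with ⟨-, -, h3⟩ | ⟨-, h3, -⟩
          · exact h3
          · exact fun h => h3 fun w hw =>
              Finset.mem_erase.2 ⟨fun e => haσ (e ▸ hw), h hw⟩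
        exact Finset.not_subset.1 this
      have hwa : w ≠ a := fun e => haσ (e ▸ hw)
      have h4 := congrFun h w
      simp only [collapse, hwa, hw, if_true, if_false, hyt.2.1 w hwt, zero_add] at h4
      have h5 := hy₁.1 w
      rw [← div_le_div_iff_of_pos_right hc]
      linarith
    intro y₁ hy₁ y₂ hy₂ h
    have haa := le_antisymm (key _ hy₁ _ hy₂ h) (key _ hy₂ _ hy₁ h.symm)
    ext w
    by_cases hwa : w = a
    · rw [hwa, haa]
    · have h4 := congrFun h w
      simpa only [collapse, hwa, if_false, haa, add_left_inj] using h4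
  · intro y hy
    obtain ⟨s, hs, hys, hpos⟩ := exists_support hy
    have has := haN hs
    by_cases hσs : σ ⊆ s
    swap
    · exact ⟨y, mem_space_iff.2 ⟨s, Or.inl ⟨has, hs, hσs⟩, hys⟩,
        collapse_eq_self (hys.2.1 a has)⟩
    obtain ⟨w₀, hw₀, hmin⟩ := σ.exists_min_image y hσ'
    set m := y w₀
    have hm : 0 < m := hpos _ (hσs hw₀)
    set r := s.filter fun w => ¬ (w ∈ σ ∧ y w = m) with hr
    have har : a ∉ r := fun h => has (Finset.mem_filter.1 h).1
    have hne : ∀ w ∈ s, w ≠ a := fun w hw e => has (e ▸ hw)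
    let y' : ℕ → ℝ := fun w => if w = a then σ.card * m else y w - if w ∈ σ then m else 0
    have hy'r : ∀ w, w ≠ a → w ∉ r → y' w = 0 := by
      intro w hwa hwr
      simp only [y', if_neg hwa]
      by_cases hws : w ∈ s
      · simp only [hr, Finset.mem_filter, hws, true_and, not_not] at hwr
        simp [hwr.1, hwr.2]
      · simp [hys.2.1 w hws, show w ∉ σ from fun h => hws (hσs h)]
    refine ⟨y', mem_space_iff.2
      ⟨insert a r, Or.inr ⟨Finset.mem_insert_self _ _, ?_, ?_⟩, ?_, ?_, ?_⟩,
      ?_⟩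
    · rw [Finset.erase_insert har]
      intro h
      exact (Finset.mem_filter.1 (h hw₀)).2 ⟨hw₀, rfl⟩
    · rw [Finset.erase_insert har]
      exact N.down_closed hs (Finset.union_subset (Finset.filter_subset _ _) hσs)
        (hσ'.mono Finset.subset_union_right)
    · intro w
      simp only [y']
      split_ifs with h1 h2
      · positivity
      · exact sub_nonneg.2 (hmin w h2)
      · rw [sub_zero]; exact hys.1 w
    · intro w hw
      rw [Finset.mem_insert, not_or] at hw
      exact hy'r w hw.1 hw.2
    · rw [Finset.sum_insert har, Finset.sum_subset (Finset.filter_subset _ _) fun w hw hwr =>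
        hy'r w (hne w hw) hwr]
      have h2 : ∑ w ∈ s, y' w = ∑ w ∈ s, (y w - if w ∈ σ then m else 0) :=
        Finset.sum_congr rfl fun w hw => if_neg (hne w hw)
      rw [h2, Finset.sum_sub_distrib, Finset.sum_ite_mem, Finset.inter_eq_right.2 hσs,
        Finset.sum_const, nsmul_eq_mul, hys.2.2]
      simp [y']
    · ext w
      by_cases hwa : w = a
      · simp [collapse, hwa, hys.2.1 a has]
      · simp only [collapse, hwa, if_false, y', if_true]
        split_ifs
        · field_simp; ring
        · ring

end Collapse

theorem exists_continuousMap_of_bijOn {M : ASC ℕ} (hM : M.faces.Finite) {Y : ASC U} {K : ASC V}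
    {pos : ℕ → U → ℝ} {χ : ℕ → V} (hbij : Set.BijOn (affineExt pos) M.space Y.space)
    (hχ : M.IsSimplicial K χ) :
    ∃ F : C(Y.space, K.space), ∀ (x : Y.space), ∀ y ∈ M.space, affineExt pos y = x →
      (F x : V → ℝ) = push χ y := by
  have hB : ∀ y : M.space, ∀ w, w ∉ hM.toFinset.biUnion id → (y : ℕ → ℝ) w = 0 := by
    rintro ⟨y, hy⟩ w hw
    obtain ⟨s, hs, hys⟩ := mem_space_iff.1 hy
    refine hys.2.1 w fun h => hw ?_
    simp only [Finset.mem_biUnion, Set.Finite.mem_toFinset, id]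
    exact ⟨s, hs, h⟩
  have : CompactSpace M.space := by
    refine isCompact_iff_compactSpace.1 ?_
    have : M.space = ⋃ s ∈ M.faces, simplexSet s := by ext x; simp [mem_space_iff]
    rw [this]
    exact hM.isCompact_biUnion fun s _ => isCompact_simplexSet s
  have hcont : Continuous (hbij.equiv (affineExt pos)) := by
    refine Continuous.subtype_mk (continuous_pi fun u => ?_) _
    change Continuous fun y : M.space => affineExt pos y u
    simp_rw [fun y : M.space => affineExt_apply pos (hB y) u]
    exact continuous_finsetSum _ fun w _ =>
      ((continuous_apply w).comp continuous_subtype_val).mul continuous_const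
  let e := hcont.homeoOfEquivCompactToT2
  refine ⟨⟨fun x => ⟨push χ (e.symm x), push_mem_space hχ (e.symm x).2⟩,
    Continuous.subtype_mk (Continuous.comp (g := fun y : M.space => push χ y) ?_
      e.symm.continuous) _⟩, ?_⟩
  · refine continuous_pi fun v => ?_
    simp_rw [fun y : M.space => push_apply χ (hB y) v]
    refine continuous_finsetSum _ fun w _ => ?_
    split_ifs
    · exact (continuous_apply w).comp continuous_subtype_val
    · exact continuous_const
  · intro x y hy hxy
    have : x = e ⟨y, hy⟩ := Subtype.ext hxy.symm
    rw [this]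
    simp

end ASC

namespace ASC

variable {V U : Type} [DecidableEq V]

theorem push_embedding_apply [DecidableEq U] [Fintype U] (ι : U ↪ ℕ) (x : U → ℝ) (u : U) :
    push ι x (ι u) = x u := by
  rw [push_apply (s := Finset.univ) _ (by simp)]
  simp

theorem affineExt_of_support [DecidableEq U] [Fintype U] (ι : U ↪ ℕ) {pos : ℕ → U → ℝ}
    (hpos : ∀ u, pos (ι u) = fun u' => if u' = u then 1 else 0) {y : ℕ → ℝ}
    (hy : ∀ w, w ∉ Finset.univ.map ι → y w = 0) (u : U) : affineExt pos y u = y (ι u) := by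
  rw [affineExt_apply pos hy, Finset.sum_map]
  simp [hpos]

theorem affineExt_push [DecidableEq U] [Fintype U] (ι : U ↪ ℕ) {pos : ℕ → U → ℝ}
    (hpos : ∀ u, pos (ι u) = fun u' => if u' = u then 1 else 0) (x : U → ℝ) :
    affineExt pos (push ι x) = x := by
  ext u
  rw [affineExt_of_support ι hpos, push_embedding_apply]
  intro w hw
  refine push_eq_zero (s := Finset.univ) (by simp) ?_
  rwa [← Finset.map_eq_image]

theorem single_mem_simplexSet [DecidableEq U] {s : Finset U} {u : U} (hu : u ∈ s) :
    (fun u' => if u' = u then (1 : ℝ) else 0) ∈ simplexSet s := by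
  refine ⟨fun v => ?_, fun v hv => if_neg fun e : v = u => hv (e ▸ hu), by simp [hu]⟩
  beta_reduce
  split_ifs <;> simp

/-- A sequence of moves, starting from a complex placed in `Y`, yields a subdivision of `Y` and
a homotopic map relative to `Z`. -/
theorem Mv.exists_realization [DecidableEq U] [Fintype U] {K : ASC V} {Y Z : ASC U}
    {M₀ Z₀ N : ASC ℕ} {A : Finset ℕ} {ψ₀ χ : ℕ → V} (ι : U ↪ ℕ) (hιA : ∀ u, ι u ∈ A) (hZ₀ : Z.IsSimplicial Z₀ ι)
    (hZM : Z₀.faces ⊆ M₀.faces) (hfin : M₀.faces.Finite) (hψ₀ : M₀.IsSimplicial K ψ₀)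
    {pos₀ : ℕ → U → ℝ} (hplace : ∀ s ∈ M₀.faces, InFace Y (pos₀ '' s))
    (hbij : Set.BijOn (affineExt pos₀) M₀.space Y.space)
    (hpos₀ : ∀ u, pos₀ (ι u) = fun u' => if u' = u then 1 else 0)
    {F₀ : C(Y.space, K.space)} (hF₀ : ∀ (x : Y.space), ∀ y ∈ M₀.space, affineExt pos₀ y = x →
      (F₀ x : V → ℝ) = push ψ₀ y) (h : Mv K Z₀ A M₀ ψ₀ N χ) :
    ∃ (pos : ℕ → U → ℝ) (F : C(Y.space, K.space)),
      (∀ s ∈ N.faces, InFace Y (pos '' s)) ∧ Set.BijOn (affineExt pos) N.space Y.space ∧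
      (∀ u, pos (ι u) = fun u' => if u' = u then 1 else 0) ∧
      (∀ (x : Y.space), ∀ y ∈ N.space, affineExt pos y = x → (F x : V → ℝ) = push χ y) ∧
      F₀.HomotopicRel F {x | (x : U → ℝ) ∈ Z.space} := by
  have hZspace : ∀ {P : ASC ℕ} {x : U → ℝ}, Z₀.faces ⊆ P.faces → x ∈ Z.space →
      push ι x ∈ P.space := by
    intro P x hP hx
    obtain ⟨s, hs, h⟩ := mem_space_iff.1 (push_mem_space hZ₀ hx)
    exact mem_space_iff.2 ⟨s, hP hs, h⟩
  induction h with
  | refl => exact ⟨pos₀, F₀, hplace, hbij, hpos₀, hF₀, .refl _⟩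
  | @step N χ σ a hN hσ hσZ haA haN hstar ih =>
    obtain ⟨pos, F, h1, h2, h3, h4, h5⟩ := ih
    have hσ' := N.nonempty_of_mem hσ
    have haσ := Sub.not_mem_of_singleton haN hσ
    have hc : (σ.card : ℝ) ≠ 0 := by exact_mod_cast hσ'.card_pos.ne'
    set pos' := Function.update pos a (∑ w ∈ σ, (1 / σ.card : ℝ) • pos w) with hpos'
    have haff : ∀ y ∈ (stellar N σ a).space, affineExt pos' y = affineExt pos (collapse σ a y) :=
      fun y ⟨_, t, _, hy, _⟩ => affineExt_update pos haσ hy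
    have hcol := bijOn_collapse hσ haN
    have hbij' : Set.BijOn (affineExt pos') (stellar N σ a).space Y.space :=
      (h2.comp hcol).congr fun y hy => (haff y hy).symm
    have hNfin := hN.sub.finite hfin
    have hpos'ι : ∀ u, pos' (ι u) = fun u' => if u' = u then 1 else 0 := fun u => by
      rw [hpos', Function.update_of_ne (fun e : ι u = a => haA (e ▸ hιA u)), h3]
    obtain ⟨F', hF'⟩ := exists_continuousMap_of_bijOn (K := K) (χ := χ) (Sub.stellar_finite hNfin)
      hbij' (Mv.stellar_simplicial (hN.simplicial hψ₀) hstar)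
    refine ⟨pos', F', ?_, hbij', hpos'ι, hF', h5.trans (homotopicRel_of_common_face _ _ ?_ ?_)⟩
    · rintro t (⟨g1, g2, g3⟩ | ⟨g1, g2, g3⟩)
      · refine (h1 t g2).mono ?_
        rintro _ ⟨w, hw, rfl⟩
        rw [hpos', Function.update_of_ne (fun e : w = a => g1 (e ▸ hw))]
        exact ⟨w, hw, rfl⟩
      · obtain ⟨e, he, hsub⟩ := h1 _ g3
        refine ⟨e, he, ?_⟩
        rintro _ ⟨w, hw, rfl⟩
        by_cases hwa : w = a
        · rw [hwa, hpos', Function.update_self]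
          refine (convex_simplexSet e).sum_mem (fun _ _ => by positivity) ?_ fun v hv =>
            hsub ⟨v, Finset.mem_union_right _ hv, rfl⟩
          rw [Finset.sum_const, nsmul_eq_mul, mul_one_div_cancel hc]
        · rw [hpos', Function.update_of_ne hwa]
          exact hsub ⟨w, Finset.mem_union_left _ (Finset.mem_erase.2 ⟨hwa, hw⟩), rfl⟩
    · intro x
      obtain ⟨y, hy, hyx⟩ := hbij'.surjOn x.2
      obtain ⟨t, ht, hyt⟩ := mem_space_iff.1 hy
      have e1 := h4 x _ (hcol.mapsTo hy) (by rw [← haff y hy, hyx])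
      have e2 := hF' x y hy hyx
      rcases ht with ⟨g1, g2, g3⟩ | ⟨g1, g2, g3⟩
      · rw [collapse_eq_self (hyt.2.1 a g1)] at e1
        refine ⟨_, hN.simplicial hψ₀ t g2, fun v hv => ?_⟩
        rw [e1, e2, push_eq_zero hyt.2.1 hv]
        exact ⟨rfl, rfl⟩
      · refine ⟨_, hstar _ g3 Finset.subset_union_right, fun v hv => ?_⟩
        rw [Finset.mem_insert, not_or] at hv
        rw [e1, e2]
        refine ⟨push_eq_zero (collapse_mem_simplexSet hσ' haσ g1 hyt).2.1 hv.2,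
          push_eq_zero hyt.2.1 fun h => ?_⟩
        obtain ⟨w, hw, rfl⟩ := Finset.mem_image.1 h
        by_cases hwa : w = a
        · exact hv.1 (by rw [hwa])
        · exact hv.2 (Finset.mem_image_of_mem _
            (Finset.mem_union_left _ (Finset.mem_erase.2 ⟨hwa, hw⟩)))
    · intro x hx
      have hNZ := hN.sub.le hZM
      rw [h4 x _ (hZspace hNZ hx) (affineExt_push ι h3 _),
        hF' x _ (hZspace ((hN.step hσ hσZ haA haN hstar).sub.le hZM) hx)
          (affineExt_push ι hpos'ι _)]
  | @relabel N χ χ' hN hχZ hface ih =>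
    obtain ⟨pos, F, h1, h2, h3, h4, h5⟩ := ih
    obtain ⟨F', hF'⟩ := exists_continuousMap_of_bijOn (K := K) (χ := χ') (hN.sub.finite hfin)
      h2 ((hN.relabel hχZ hface).simplicial hψ₀)
    refine ⟨pos, F', h1, h2, h3, hF', h5.trans (homotopicRel_of_common_face _ _ ?_ ?_)⟩
    · intro x
      obtain ⟨y, hy, hyx⟩ := h2.surjOn x.2
      obtain ⟨t, ht, hyt⟩ := mem_space_iff.1 hy
      refine ⟨_, hface t ht, fun v hv => ?_⟩
      rw [Finset.mem_union, not_or] at hv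
      rw [h4 x y hy hyx, hF' x y hy hyx]
      exact ⟨push_eq_zero hyt.2.1 hv.1, push_eq_zero hyt.2.1 hv.2⟩
    · intro x hx
      have hy := hZspace (hN.sub.le hZM) hx
      obtain ⟨-, t, ht, hyt, -⟩ := push_mem_space hZ₀ hx
      rw [h4 x _ hy (affineExt_push ι h3 _), hF' x _ hy (affineExt_push ι h3 _)]
      ext v
      rw [push_apply χ hyt, push_apply χ' hyt]
      exact Finset.sum_congr rfl fun w hw => by rw [hχZ t ht w hw]

/-- The image of a complex under an injection of its vertices. -/
def mapEmbedding (Y : ASC U) (ι : U ↪ ℕ) : ASC ℕ where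
  faces := {s | ∃ t ∈ Y.faces, t.map ι = s}
  nonempty_of_mem := by
    rintro _ ⟨t, ht, rfl⟩
    exact (Y.nonempty_of_mem ht).map
  down_closed := by
    rintro _ t ⟨s, hs, rfl⟩ hts hne
    obtain ⟨r, hr, rfl⟩ := Finset.subset_map_iff.1 hts
    exact ⟨r, Y.down_closed hs hr (Finset.map_nonempty.1 hne), rfl⟩

theorem isSimplicial_mapEmbedding (Y : ASC U) (ι : U ↪ ℕ) : Y.IsSimplicial (Y.mapEmbedding ι) ι :=
  fun s hs => ⟨s, hs, Finset.map_eq_image _ _⟩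

theorem eq_zero_of_mem_space_mapEmbedding [Fintype U] {Y : ASC U} {ι : U ↪ ℕ} {y : ℕ → ℝ}
    (hy : y ∈ (Y.mapEmbedding ι).space) (w : ℕ) (hw : w ∉ Finset.univ.map ι) : y w = 0 := by
  obtain ⟨-, _, ⟨t, -, rfl⟩, hy, -⟩ := hy
  exact hy w fun h => hw (Finset.map_subset_map.2 (Finset.subset_univ t) h)

theorem bijOn_affineExt_mapEmbedding [DecidableEq U] [Fintype U] (Y : ASC U) (ι : U ↪ ℕ)
    {pos : ℕ → U → ℝ} (hpos : ∀ u, pos (ι u) = fun u' => if u' = u then 1 else 0) :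
    Set.BijOn (affineExt pos) (Y.mapEmbedding ι).space Y.space := by
  refine ⟨?_, ?_, ?_⟩
  · intro y hy
    obtain ⟨_, ⟨t, ht, rfl⟩, hyt⟩ := mem_space_iff.1 hy
    refine mem_space_iff.2 ⟨t, ht, affineExt_mem_simplexSet hyt ?_⟩
    rintro _ ⟨w, hw, rfl⟩
    obtain ⟨u, hu, rfl⟩ := Finset.mem_map.1 (Finset.mem_coe.1 hw)
    rw [hpos]
    exact single_mem_simplexSet hu
  · intro y₁ hy₁ y₂ hy₂ h
    ext w
    by_cases hw : w ∈ Finset.univ.map ι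
    · obtain ⟨u, -, rfl⟩ := Finset.mem_map.1 hw
      rw [← affineExt_of_support ι hpos (eq_zero_of_mem_space_mapEmbedding hy₁), h,
        affineExt_of_support ι hpos (eq_zero_of_mem_space_mapEmbedding hy₂)]
    · rw [eq_zero_of_mem_space_mapEmbedding hy₁ w hw, eq_zero_of_mem_space_mapEmbedding hy₂ w hw]
  · intro x hx
    refine ⟨push ι x, push_mem_space (Y.isSimplicial_mapEmbedding ι) hx,
      affineExt_push ι hpos x⟩

end ASC

/-- **Simplexwise injective approximation.** Let `X` be weakly Cohen–Macaulay of level `n`,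
`Y` a finite simplicial complex of dimension at most `n`, `Z ⊆ Y` a subcomplex and
`f₀ : Y → X` a simplicial map.  Then `f₀` is homotopic rel `Z` to a map `f₁` which is
simplicial with respect to a subdivision `M` of `Y` leaving `Z` unchanged, and which is
simplexwise injective relative to `Z`: any edge of `M` whose endpoints have the same
`f₁`-image lies in `Z`. -/
theorem simplexwise_injective_approximation {V U : Type} [DecidableEq V] [DecidableEq U]
    [Fintype U] (K : ASC V) (n : ℕ) (hK : WCM K (n : ℤ))
    (Y Z : ASC U) (hdim : ∀ s ∈ Y.faces, s.card ≤ n + 1) (hZ : Z.faces ⊆ Y.faces)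
    (φ : U → V) (hφ : Y.IsSimplicial K φ) :
    ∃ (W : Type) (M : ASC W) (pos : W → U → ℝ) (ι : U → W) (ψ : W → V),
      -- `M` is a subdivision of `Y` via the vertex positions `pos`:
      (∀ s ∈ M.faces, ∃ t ∈ Y.faces, ∀ w ∈ s, ∀ u, u ∉ t → pos w u = 0) ∧
      Set.BijOn (affineExt pos) M.space Y.space ∧
      -- the subdivision leaves `Z` unchanged:
      (∀ u, {u} ∈ Z.faces → pos (ι u) = fun u' => if u' = u then (1 : ℝ) else 0) ∧
      (∀ s ∈ Z.faces, ∃ s' ∈ M.faces, ∀ w, w ∈ s' ↔ ∃ u ∈ s, w = ι u) ∧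
      (∀ u, {u} ∈ Z.faces → ψ (ι u) = φ u) ∧
      -- `f₁` is simplicial with respect to the subdivision:
      (∀ s ∈ M.faces, ∃ t ∈ K.faces, ∀ v, v ∈ t ↔ ∃ w ∈ s, v = ψ w) ∧
      -- simplexwise injectivity relative to `Z`:
      (∀ s ∈ M.faces, ∀ w ∈ s, ∀ w' ∈ s, ψ w = ψ w' → w = w' ∨
        ∃ t ∈ Z.faces, (∀ u, u ∉ t → pos w u = 0) ∧ ∀ u, u ∉ t → pos w' u = 0) ∧
      -- `f₁` is homotopic to `f₀` rel `Z`: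
      ∃ F₀ F₁ : C(↥Y.space, ↥K.space),
        (∀ x : ↥Y.space, (F₀ x : V → ℝ) = ASC.push φ (x : U → ℝ)) ∧
        (∀ x : ↥Y.space, ∀ y : ↥M.space, affineExt pos (y : W → ℝ) = (x : U → ℝ) →
          (F₁ x : V → ℝ) = ASC.push ψ (y : W → ℝ)) ∧
        F₀.HomotopicRel F₁ {x : ↥Y.space | (x : U → ℝ) ∈ Z.space} := by
  obtain ⟨z⟩ := hK.1.1 (by omega)
  obtain ⟨v₀, -⟩ := ASC.exists_pos_of_mem_space z.2
  let ι : U ↪ ℕ := (Fintype.equivFin U).toEmbedding.trans Fin.valEmbedding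
  let ψ₀ : ℕ → V := Function.extend ι φ fun _ => v₀
  have hψ₀ι : ∀ u, ψ₀ (ι u) = φ u := ι.injective.extend_apply _ _
  let pos₀ : ℕ → U → ℝ := Function.extend ι (fun u u' => if u' = u then 1 else 0) 0
  have hpos₀ : ∀ u, pos₀ (ι u) = fun u' => if u' = u then 1 else 0 := ι.injective.extend_apply _ _
  have hfin : (Y.mapEmbedding ι).faces.Finite := Y.faces.toFinite.image _
  have hψ₀ : (Y.mapEmbedding ι).IsSimplicial K ψ₀ := by
    rintro _ ⟨t, ht, rfl⟩
    rw [Finset.map_eq_image, Finset.image_image, show ψ₀ ∘ ι = φ from funext hψ₀ι]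
    exact hφ t ht
  have hZY : (Z.mapEmbedding ι).faces ⊆ (Y.mapEmbedding ι).faces :=
    fun _ ⟨t, ht, h⟩ => ⟨t, hZ ht, h⟩
  have hplace : ∀ s ∈ (Y.mapEmbedding ι).faces, ASC.InFace Y (pos₀ '' s) := by
    rintro _ ⟨t, ht, rfl⟩
    refine ⟨t, ht, ?_⟩
    rintro _ ⟨w, hw, rfl⟩
    obtain ⟨u, hu, rfl⟩ := Finset.mem_map.1 (Finset.mem_coe.1 hw)
    rw [hpos₀]
    exact ASC.single_mem_simplexSet hu
  let F₀ : C(Y.space, K.space) := ⟨fun x => ⟨ASC.push φ x, ASC.push_mem_space hφ x.2⟩,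
    ((ASC.continuous_push φ).comp continuous_subtype_val).subtype_mk _⟩
  have hF₀ : ∀ (x : Y.space), ∀ y ∈ (Y.mapEmbedding ι).space, affineExt pos₀ y = x →
      (F₀ x : V → ℝ) = ASC.push ψ₀ y := by
    intro x y hy hyx
    have hy0 := ASC.eq_zero_of_mem_space_mapEmbedding hy
    ext v
    change ASC.push φ x v = _
    rw [← hyx, ASC.push_apply (s := Finset.univ) _ (by simp), ASC.push_apply ψ₀ hy0,
      Finset.sum_map]
    simp only [hψ₀ι, ASC.affineExt_of_support ι hpos₀ hy0]
  obtain ⟨M, ψ, hmv, hψA, hinj⟩ := ASC.exists_mv_injective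
    (fun K d => ASC.fillConn_of_isConn K d) n K hK (Y.mapEmbedding ι) (Z.mapEmbedding ι) ψ₀
    (Finset.univ.map ι) hfin
    (by
      rintro _ ⟨t, -, rfl⟩
      exact Finset.map_subset_map.2 (Finset.subset_univ t))
    (by
      rintro _ ⟨t, ht, rfl⟩
      rw [Finset.card_map]
      exact hdim t ht) hZY hψ₀
  obtain ⟨pos, F₁, h1, h2, h3, h4, h5⟩ := hmv.exists_realization ι (by simp)
    (Z.isSimplicial_mapEmbedding ι) hZY hfin hψ₀ hplace
    (ASC.bijOn_affineExt_mapEmbedding Y ι hpos₀) hpos₀ hF₀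
  refine ⟨ℕ, M, pos, ι, ψ, ?_, h2, fun u _ => h3 u, ?_, ?_, ?_, ?_, F₀, F₁, fun _ => rfl,
    fun x y => h4 x y y.2, h5⟩
  · intro s hs
    obtain ⟨t, ht, h⟩ := h1 s hs
    exact ⟨t, ht, fun w hw => (h ⟨w, hw, rfl⟩).2.1⟩
  · intro s hs
    exact ⟨s.map ι, hmv.sub.le hZY ⟨s, hs, rfl⟩, fun w => by simp [eq_comm]⟩
  · intro u _
    rw [hψA _ (by simp), hψ₀ι]
  · intro s hs
    exact ⟨s.image ψ, hmv.simplicial hψ₀ s hs, fun v => by simp [eq_comm]⟩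
  · intro s hs w hw w' hw' h
    refine (hinj s hs w hw w' hw' h).imp_right ?_
    rintro ⟨t, ht, e⟩
    have key : ∀ x ∈ ({w, w'} : Finset ℕ), ∀ u, u ∉ t → pos x u = 0 := by
      intro x hx u hu
      rw [← e] at hx
      obtain ⟨u', hu', rfl⟩ := Finset.mem_map.1 hx
      rw [h3]
      exact if_neg fun e : u = u' => hu (e ▸ hu')
    exact ⟨t, ht, key w (by simp), key w' (by simp)⟩
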